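/- arXiv:2410.04031 — 8 statements merged into one kernel-verified Lean document; each statement's English description precedes it below -/
import Mathlib

section
/- Let n ≥ 1, 0 < α < n, 1 < p < n/α, and let q be defined by 1/p − 1/q = α/n, and let w be a weight on ℝⁿ. If there exists a constant C > 0 such that ‖w·M_α f‖_{L^{q,∞}} ≤ C·‖f‖_{L^p(w^p)} for every f ∈ L^p(w^p), then w ∈ A_{p,q}^*. -/
open MeasureTheory Set
open scoped ENNReal

noncomputable section

/-- An axis-parallel cube in `ℝⁿ` (realized as `Fin n → ℝ`) with positive finite side length. -/
def IsCube (n : ℕ) (Q : Set (Fin n → ℝ)) : Prop :=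
  ∃ (a : Fin n → ℝ) (h : ℝ), 0 < h ∧ Q = Set.univ.pi fun i => Set.Icc (a i) (a i + h)

/-- The weak `L^p` quasinorm `sup_{t>0} t · |{x : g x > t}|^{1/p}` of an `ℝ≥0∞`-valued
function on `ℝⁿ`. -/
def wnormE (n : ℕ) (p : ℝ) (g : (Fin n → ℝ) → ℝ≥0∞) : ℝ≥0∞ :=
  ⨆ (t : ℝ) (_ : 0 < t), ENNReal.ofReal t * volume {x | ENNReal.ofReal t < g x} ^ (1 / p)

/-- The Hardy–Littlewood maximal operator: supremum of averages of `|f|` over cubes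
containing `x`. -/
def maximalFn (n : ℕ) (f : (Fin n → ℝ) → ℝ) (x : Fin n → ℝ) : ℝ≥0∞ :=
  ⨆ (Q : Set (Fin n → ℝ)) (_ : IsCube n Q) (_ : x ∈ Q),
    (volume Q)⁻¹ * ∫⁻ y in Q, ENNReal.ofReal |f y|

/-- The fractional maximal operator `M_α`. -/
def fracMaximalFn (n : ℕ) (α : ℝ) (f : (Fin n → ℝ) → ℝ) (x : Fin n → ℝ) : ℝ≥0∞ :=
  ⨆ (Q : Set (Fin n → ℝ)) (_ : IsCube n Q) (_ : x ∈ Q),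
    volume Q ^ (α / (n : ℝ)) * ((volume Q)⁻¹ * ∫⁻ y in Q, ENNReal.ofReal |f y|)

/-- The multiplier `A_p^*` characteristic
`[w]_{A_p^*} = sup_Q (|Q|⁻¹·‖w·χ_Q‖_{L^{1,∞}})·(⨍_Q w^{1-p'})^{p-1}`, with `p' = p/(p-1)`. -/
def ApStarConst (n : ℕ) (p : ℝ) (w : (Fin n → ℝ) → ℝ) : ℝ≥0∞ :=
  ⨆ (Q : Set (Fin n → ℝ)) (_ : IsCube n Q),
    (volume Q)⁻¹ * wnormE n 1 (Q.indicator fun x => ENNReal.ofReal (w x)) *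
      ((volume Q)⁻¹ * ∫⁻ x in Q, ENNReal.ofReal (w x ^ (1 - p / (p - 1)))) ^ (p - 1)

/-- The multiplier `A_{p,q}^*` characteristic
`[w]_{A_{p,q}^*} = sup_Q (|Q|⁻¹·‖w^q·χ_Q‖_{L^{1,∞}})^{1/q}·(⨍_Q w^{-p'})^{1/p'}`,
with `p' = p/(p-1)` and `1/p' = 1 - 1/p`. -/
def ApqStarConst (n : ℕ) (p q : ℝ) (w : (Fin n → ℝ) → ℝ) : ℝ≥0∞ :=
  ⨆ (Q : Set (Fin n → ℝ)) (_ : IsCube n Q),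
    ((volume Q)⁻¹ * wnormE n 1 (Q.indicator fun x => ENNReal.ofReal (w x ^ q))) ^ (1 / q) *
      ((volume Q)⁻¹ * ∫⁻ x in Q, ENNReal.ofReal (w x ^ (-(p / (p - 1))))) ^ (1 - 1 / p)

/-- The Muckenhoupt `A_p` characteristic `[w]_{A_p} = sup_Q (⨍_Q w)·(⨍_Q w^{1-p'})^{p-1}`. -/
def ApConst (n : ℕ) (p : ℝ) (w : (Fin n → ℝ) → ℝ) : ℝ≥0∞ :=
  ⨆ (Q : Set (Fin n → ℝ)) (_ : IsCube n Q),
    ((volume Q)⁻¹ * ∫⁻ x in Q, ENNReal.ofReal (w x)) *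
      ((volume Q)⁻¹ * ∫⁻ x in Q, ENNReal.ofReal (w x ^ (1 - p / (p - 1)))) ^ (p - 1)

/-- The Muckenhoupt `A_{p,q}` characteristic
`[w]_{A_{p,q}} = sup_Q (⨍_Q w^q)^{1/q}·(⨍_Q w^{-p'})^{1/p'}`. -/
def ApqConst (n : ℕ) (p q : ℝ) (w : (Fin n → ℝ) → ℝ) : ℝ≥0∞ :=
  ⨆ (Q : Set (Fin n → ℝ)) (_ : IsCube n Q),
    ((volume Q)⁻¹ * ∫⁻ x in Q, ENNReal.ofReal (w x ^ q)) ^ (1 / q) *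
      ((volume Q)⁻¹ * ∫⁻ x in Q, ENNReal.ofReal (w x ^ (-(p / (p - 1))))) ^ (1 - 1 / p)

lemma aux_sup {ι : Sort*} (a b C : ℝ≥0∞) (e : ℝ) (he : 0 < e) (T : ι → ℝ≥0∞)
    (h : ∀ i, a * (b * T i) ^ e ≤ C) : a * (b * ⨆ i, T i) ^ e ≤ C := by
  have key : ∀ x : ℝ≥0∞, a * (b * x) ^ e ≤ C ↔ a ^ (1 / e) * b * x ≤ C ^ (1 / e) := by
    intro x
    have : a * (b * x) ^ e = (a ^ (1 / e) * b * x) ^ e := by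
      rw [mul_assoc, ENNReal.mul_rpow_of_nonneg (a ^ (1 / e)) _ he.le, ← ENNReal.rpow_mul,
        one_div_mul_cancel he.ne', ENNReal.rpow_one]
    rw [this, one_div, ← ENNReal.le_rpow_inv_iff he]
  rw [key, ENNReal.mul_iSup]
  exact iSup_le fun i => (key _).1 (h i)

lemma aux_cube {n : ℕ} {Q : Set (Fin n → ℝ)} (hQ : IsCube n Q) :
    MeasurableSet Q ∧ volume Q ≠ 0 ∧ volume Q ≠ ∞ := by
  obtain ⟨a, h, hh, rfl⟩ := hQ
  refine ⟨MeasurableSet.univ_pi fun i => measurableSet_Icc, ?_, ?_⟩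
  · rw [volume_pi_pi]
    simp [Finset.prod_eq_zero_iff, hh]
  · rw [volume_pi_pi]
    simp

lemma aux_alg (V I S E C : ℝ≥0∞) (hV0 : V ≠ 0) (hV : V ≠ ∞) (hI0 : I ≠ 0) (hI : I ≠ ∞)
    (p q t a : ℝ) (hp : 1 < p) (hq0 : 0 < q) (hq : 1 / p - 1 / q = a) (ht : 0 < t)
    (hS : S = ENNReal.ofReal t ^ (1 / q))
    (h : S * (V ^ a * (V⁻¹ * I)) * E ^ (1 / q) ≤ C * I ^ (1 / p)) :
    (V⁻¹ * (ENNReal.ofReal t * E)) ^ (1 / q) * (V⁻¹ * I) ^ (1 - 1 / p) ≤ C := by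
  have hq1 : 0 ≤ 1 / q := by positivity
  have hp1 : 0 ≤ 1 - 1 / p := by
    rw [sub_nonneg, div_le_one (by linarith)]; exact hp.le
  have e1 : V ^ a * V⁻¹ = V⁻¹ ^ (1 / q) * V⁻¹ ^ (1 - 1 / p) := by
    rw [ENNReal.inv_rpow, ENNReal.inv_rpow, ← ENNReal.rpow_neg, ← ENNReal.rpow_neg,
      ← ENNReal.rpow_neg_one, ← ENNReal.rpow_add _ _ hV0 hV, ← ENNReal.rpow_add _ _ hV0 hV]
    congr 1
    linarith
  have e2 : I ^ (1 - 1 / p) * I ^ (1 / p) = I := by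
    rw [← ENNReal.rpow_add _ _ hI0 hI]
    simp
  have f0 : I ^ (1 / p) ≠ 0 := by
    simp [ENNReal.rpow_eq_zero_iff, hI0, hI]
  have f1 : I ^ (1 / p) ≠ ∞ := by
    simp [ENNReal.rpow_eq_top_iff, hI0, hI]
  rw [← ENNReal.mul_le_mul_iff_left f0 f1]
  refine le_trans (le_of_eq ?_) h
  rw [ENNReal.mul_rpow_of_nonneg _ _ hq1, ENNReal.mul_rpow_of_nonneg _ _ hq1,
    ENNReal.mul_rpow_of_nonneg _ _ hp1, ← hS]
  calc _ = S * ((V⁻¹ ^ (1 / q) * V⁻¹ ^ (1 - 1 / p)) * (I ^ (1 - 1 / p) * I ^ (1 / p))) *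
        E ^ (1 / q) := by ring
    _ = _ := by rw [← e1, e2]; ring

/-- Necessity for the fractional maximal operator: if the multiplier
weak-type inequality `‖w·M_α f‖_{L^{q,∞}} ≤ C·‖f‖_{L^p(w^p)}` holds for all `f ∈ L^p(w^p)`
for some `C > 0`, then `w ∈ A_{p,q}^*`. -/
theorem statement5 (n : ℕ) (hn : 1 ≤ n) (α : ℝ) (hα : 0 < α) (hαn : α < (n : ℝ))
    (p : ℝ) (hp : 1 < p) (hpn : p < (n : ℝ) / α) (q : ℝ)
    (hq : 1 / p - 1 / q = α / (n : ℝ))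
    (w : (Fin n → ℝ) → ℝ) (hwm : Measurable w) (hw0 : ∀ x, 0 ≤ w x)
    (hwpos : ∀ᵐ x ∂(volume : Measure (Fin n → ℝ)), 0 < w x)
    (hbound : ∃ C : ℝ, 0 < C ∧ ∀ f : (Fin n → ℝ) → ℝ, Measurable f →
        (∫⁻ x, ENNReal.ofReal (|f x| ^ p * w x ^ p)) < ∞ →
        wnormE n q (fun x => ENNReal.ofReal (w x) * fracMaximalFn n α f x) ≤
          ENNReal.ofReal C * (∫⁻ x, ENNReal.ofReal (|f x| ^ p * w x ^ p)) ^ (1 / p)) :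
    ApqStarConst n p q w < ∞ := by
  obtain ⟨C, hC, hb⟩ := hbound
  have hn0 : (0 : ℝ) < n := by exact_mod_cast hn
  have hp0 : 0 < p := by linarith
  have hq0 : 0 < q := by
    have h1 : α / n < 1 / p := by
      rw [lt_div_iff₀ hα] at hpn
      rw [div_lt_div_iff₀ hn0 hp0]
      linarith
    have h2 : 0 < 1 / q := by linarith
    exact one_div_pos.1 h2
  have hp1 : 0 < 1 - 1 / p := by
    rw [sub_pos, div_lt_one hp0]; exact hp
  set r : ℝ := p / (p - 1) with hr
  have hpm : 0 < p - 1 := by linarith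
  have hr0 : 0 < r := by positivity
  refine lt_of_le_of_lt (b := ENNReal.ofReal C) ?_ ENNReal.ofReal_lt_top
  refine iSup₂_le fun Q hQ => ?_
  obtain ⟨hQm, hV0, hV⟩ := aux_cube hQ
  -- truncations
  let F : ℕ → (Fin n → ℝ) → ℝ := fun k =>
    {x | 1 / ((k : ℝ) + 1) < w x}.indicator fun x => w x ^ (-r)
  have hFnn : ∀ k x, 0 ≤ F k x := fun k x =>
    Set.indicator_nonneg (fun y _ => Real.rpow_nonneg (hw0 y) _) x
  have hFm : ∀ k, Measurable (F k) := fun k =>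
    (hwm.pow_const _).indicator (measurableSet_lt measurable_const hwm)
  have hsup : ∫⁻ x in Q, ENNReal.ofReal (w x ^ (-r)) =
      ⨆ k, ∫⁻ x in Q, ENNReal.ofReal (F k x) := by
    rw [← lintegral_iSup (fun k => (hFm k).ennreal_ofReal)]
    · refine lintegral_congr fun x => le_antisymm ?_ ?_
      · rcases (hw0 x).eq_or_lt with h0 | h0
        · rw [← h0, Real.zero_rpow (by linarith)]; simp
        · obtain ⟨k, hk⟩ := exists_nat_one_div_lt h0
          refine le_iSup_of_le k ?_
          have : F k x = w x ^ (-r) := Set.indicator_of_mem (s := {x | 1 / ((k : ℝ) + 1) < w x}) hk _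
          rw [this]
      · refine iSup_le fun k => ENNReal.ofReal_le_ofReal ?_
        exact Set.indicator_le_self' (s := {x | 1 / ((k : ℝ) + 1) < w x})
          (f := fun x => w x ^ (-r)) (fun y _ => Real.rpow_nonneg (hw0 y) _) x
    · intro k l hkl x
      refine ENNReal.ofReal_le_ofReal ?_
      refine Set.indicator_le_indicator_of_subset ?_ (fun y => Real.rpow_nonneg (hw0 y) _) x
      intro y hy
      have hkl' : (k : ℝ) + 1 ≤ (l : ℝ) + 1 := by
        have : (k : ℝ) ≤ l := by exact_mod_cast hkl
        linarith
      have hk0 : (0 : ℝ) < (k : ℝ) + 1 := by positivity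
      have hy' : 1 / ((k : ℝ) + 1) < w y := hy
      show 1 / ((l : ℝ) + 1) < w y
      exact lt_of_le_of_lt (one_div_le_one_div_of_le hk0 hkl') hy'
  rw [hsup]
  refine aux_sup _ _ _ _ hp1 _ fun k => ?_
  set I := ∫⁻ x in Q, ENNReal.ofReal (F k x) with hI
  rw [mul_comm]
  unfold wnormE
  rw [iSup_subtype']
  refine aux_sup _ _ _ _ (one_div_pos.2 hq0) _ fun t => ?_
  obtain ⟨t, ht⟩ := t
  rw [mul_comm]
  simp only [div_one, ENNReal.rpow_one]
  by_cases hI0 : I = 0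
  · rw [hI0, mul_zero, ENNReal.zero_rpow_of_pos hp1, mul_zero]; exact zero_le
  have hIt : I ≠ ∞ := by
    refine ne_top_of_le_ne_top (b := ENNReal.ofReal ((1 / ((k : ℝ) + 1)) ^ (-r)) * volume Q)
      (ENNReal.mul_ne_top ENNReal.ofReal_ne_top hV) ?_
    rw [← setLIntegral_const]
    refine lintegral_mono fun x => ENNReal.ofReal_le_ofReal ?_
    by_cases hy : 1 / ((k : ℝ) + 1) < w x
    · have : F k x = w x ^ (-r) := Set.indicator_of_mem (s := {x | 1 / ((k : ℝ) + 1) < w x}) hy _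
      rw [this]
      exact Real.rpow_le_rpow_of_nonpos (by positivity) (le_of_lt hy) (by linarith)
    · have : F k x = 0 := Set.indicator_of_notMem (s := {x | 1 / ((k : ℝ) + 1) < w x}) hy _
      rw [this]
      positivity
  let f : (Fin n → ℝ) → ℝ := Q.indicator (F k)
  have hfm : Measurable f := (hFm k).indicator hQm
  have hf1 : ∫⁻ y in Q, ENNReal.ofReal |f y| = I := by
    refine setLIntegral_congr_fun hQm fun x hx => ?_
    simp only [f, Set.indicator_of_mem hx, abs_of_nonneg (hFnn k x)]
  have hf2 : ∫⁻ x, ENNReal.ofReal (|f x| ^ p * w x ^ p) = I := by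
    rw [hI, ← lintegral_indicator hQm]
    refine lintegral_congr fun x => ?_
    by_cases hx : x ∈ Q
    · simp only [f, Set.indicator_of_mem hx, abs_of_nonneg (hFnn k x)]
      congr 1
      by_cases hy : 1 / ((k : ℝ) + 1) < w x
      · have : F k x = w x ^ (-r) := Set.indicator_of_mem (s := {x | 1 / ((k : ℝ) + 1) < w x}) hy _
        have hw : 0 < w x := lt_trans (by positivity) hy
        rw [this, ← Real.rpow_mul hw.le, ← Real.rpow_add hw]
        congr 1
        rw [hr]; field_simp; ring
      · have : F k x = 0 := Set.indicator_of_notMem (s := {x | 1 / ((k : ℝ) + 1) < w x}) hy _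
        rw [this, Real.zero_rpow hp0.ne', zero_mul]
    · simp [f, Set.indicator_of_notMem hx, Real.zero_rpow hp0.ne']
  have hb' := hb f hfm (by rw [hf2]; exact lt_top_iff_ne_top.2 hIt)
  rw [hf2] at hb'
  set A := volume Q ^ (α / (n : ℝ)) * ((volume Q)⁻¹ * I) with hA
  have hA0 : A ≠ 0 := by
    simp [hA, ENNReal.rpow_eq_zero_iff, hV0, hV, hI0]
  have hAt : A ≠ ∞ := by
    refine ENNReal.mul_ne_top ?_ (ENNReal.mul_ne_top (by simpa using hV0) hIt)
    simp [ENNReal.rpow_eq_top_iff, hV0, hV]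
  have hAM : ∀ x ∈ Q, A ≤ fracMaximalFn n α f x := by
    intro x hx
    rw [hA, ← hf1]
    exact le_iSup_of_le Q (le_iSup₂_of_le hQ hx le_rfl)
  refine aux_alg (volume Q) I (ENNReal.ofReal (t ^ (1 / q))) _ _ hV0 hV hI0 hIt p q t (α / n) hp hq0 hq ht
    (ENNReal.ofReal_rpow_of_pos ht).symm (le_trans ?_ hb')
  rw [← hA]
  have hs : 0 < t ^ (1 / q) := Real.rpow_pos_of_pos ht _
  refine le_iSup₂_of_le (t ^ (1 / q) * A.toReal) (mul_pos hs (ENNReal.toReal_pos hA0 hAt)) ?_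
  have hlev : ENNReal.ofReal (t ^ (1 / q) * A.toReal) = ENNReal.ofReal (t ^ (1 / q)) * A := by
    rw [ENNReal.ofReal_mul hs.le, ENNReal.ofReal_toReal hAt]
  rw [hlev]
  refine mul_le_mul_right (ENNReal.rpow_le_rpow (measure_mono ?_) (by positivity)) _
  intro x hx
  simp only [Set.mem_ofPred_eq] at hx ⊢
  by_cases hxQ : x ∈ Q
  · rw [Set.indicator_of_mem hxQ] at hx
    have h1 : t < w x ^ q := (ENNReal.ofReal_lt_ofReal_iff_of_nonneg ht.le).1 hx
    have h2 : t ^ (1 / q) < w x := by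
      have := Real.rpow_lt_rpow ht.le h1 (one_div_pos.2 hq0)
      rwa [← Real.rpow_mul (hw0 x), mul_one_div_cancel hq0.ne', Real.rpow_one] at this
    calc ENNReal.ofReal (t ^ (1 / q)) * A < ENNReal.ofReal (w x) * A := by
          rw [ENNReal.mul_lt_mul_iff_left hA0 hAt]
          exact (ENNReal.ofReal_lt_ofReal_iff_of_nonneg hs.le).2 h2
      _ ≤ _ := mul_le_mul_right (hAM x hxQ) _
  · rw [Set.indicator_of_notMem hxQ] at hx
    exact absurd hx not_lt_zero
end
end

section
/- Let n ≥ 1, 1 < p < ∞, and let w be a weight on ℝⁿ with w ∈ A_p^*. Then for every s > 1, the function w^{1/s} is locally integrable, belongs to the Muckenhoupt class A_p, and satisfies [w^{1/s}]_{A_p} ≤ s'·[w]_{A_p^*}^{1/s}, where s' = s/(s−1). -/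
open MeasureTheory Set
open scoped ENNReal

noncomputable section

theorem kolm_real {α : Type*} [MeasurableSpace α] (μ : Measure α) [IsProbabilityMeasure μ]
    (f : α → ℝ) (hf : Measurable f) (hf0 : ∀ x, 0 ≤ f x) (r : ℝ) (hr0 : 0 < r) (hr1 : r < 1)
    (K : ℝ) (hK : 0 < K) (h : ∀ t : ℝ, 0 < t → ENNReal.ofReal t * μ {x | t < f x} ≤ ENNReal.ofReal K) :
    ∫⁻ x, ENNReal.ofReal (f x ^ r) ∂μ ≤ ENNReal.ofReal (1 / (1 - r)) * ENNReal.ofReal K ^ r := by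
  rw [lintegral_rpow_eq_lintegral_meas_lt_mul μ (Filter.Eventually.of_forall hf0) hf.aemeasurable hr0,
    ← Ioc_union_Ioi_eq_Ioi hK.le]
  have h1 : ∫⁻ t in Ioc 0 K, μ {a : α | t < f a} * ENNReal.ofReal (t ^ (r - 1)) ≤
      ENNReal.ofReal (K ^ r / r) := by
    calc _ ≤ ∫⁻ t in Ioc 0 K, ENNReal.ofReal (t ^ (r - 1)) := by
          apply lintegral_mono
          intro t
          calc _ ≤ 1 * ENNReal.ofReal (t ^ (r - 1)) := by
                  exact mul_le_mul_left prob_le_one _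
            _ = _ := one_mul _
      _ = ENNReal.ofReal (K ^ r / r) := by
          rw [← ofReal_integral_eq_lintegral_ofReal]
          · rw [← intervalIntegral.integral_of_le hK.le, integral_rpow (Or.inl (by linarith))]
            simp [Real.zero_rpow hr0.ne']
          · exact (intervalIntegrable_iff_integrableOn_Ioc_of_le hK.le).1
              (intervalIntegral.intervalIntegrable_rpow' (by linarith))
          · filter_upwards [ae_restrict_mem measurableSet_Ioc] with t ht
            exact Real.rpow_nonneg ht.1.le _
  have h2 : ∫⁻ t in Ioi K, μ {a : α | t < f a} * ENNReal.ofReal (t ^ (r - 1)) ≤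
      ENNReal.ofReal (K ^ r / (1 - r)) := by
    calc _ ≤ ∫⁻ t in Ioi K, ENNReal.ofReal (K * t ^ (r - 2)) := by
          apply setLIntegral_mono' measurableSet_Ioi
          intro t ht
          have ht0 : 0 < t := hK.trans ht
          have e : t ^ (r - 1) = t * t ^ (r - 2) := by
            rw [← Real.rpow_one_add' ht0.le (by linarith)]
            ring_nf
          rw [e, ENNReal.ofReal_mul ht0.le, ENNReal.ofReal_mul hK.le, ← mul_assoc,
            mul_comm (μ _)]
          gcongr
          exact h t ht0
      _ = ENNReal.ofReal (K ^ r / (1 - r)) := by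
          rw [← ofReal_integral_eq_lintegral_ofReal]
          · rw [integral_const_mul, integral_Ioi_rpow_of_lt (by linarith) hK]
            congr 1
            have e : K ^ r = K * K ^ (r - 2 + 1) := by
              rw [← Real.rpow_one_add' hK.le (by linarith)]
              ring_nf
            rw [e]
            have : r - 2 + 1 ≠ 0 := by linarith
            have : 1 - r ≠ 0 := by linarith
            field_simp
            ring
          · exact (integrableOn_Ioi_rpow_of_lt (by linarith) hK).const_mul K
          · filter_upwards [ae_restrict_mem measurableSet_Ioi] with t ht
            exact mul_nonneg hK.le (Real.rpow_nonneg (hK.trans ht).le _)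
  have hr2 : 0 < 1 - r := by linarith
  have hKr : 0 < K ^ r := Real.rpow_pos_of_pos hK r
  calc _ ≤ ENNReal.ofReal r * (ENNReal.ofReal (K ^ r / r) + ENNReal.ofReal (K ^ r / (1 - r))) := by
        gcongr
        exact (lintegral_union_le _ _ _).trans (add_le_add h1 h2)
    _ = _ := by
        rw [← ENNReal.ofReal_add (by positivity) (by positivity), ← ENNReal.ofReal_mul hr0.le,
          ENNReal.ofReal_rpow_of_pos hK, ← ENNReal.ofReal_mul (by positivity)]
        congr 1
        field_simp
        ring

theorem kolm {α : Type*} [MeasurableSpace α] (μ : Measure α) [IsProbabilityMeasure μ]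
    (f : α → ℝ) (hf : Measurable f) (hf0 : ∀ x, 0 ≤ f x) (r : ℝ) (hr0 : 0 < r) (hr1 : r < 1)
    (K : ℝ≥0∞) (hK : K ≠ ∞) (h : ∀ t : ℝ, 0 < t → ENNReal.ofReal t * μ {x | t < f x} ≤ K) :
    ∫⁻ x, ENNReal.ofReal (f x ^ r) ∂μ ≤ ENNReal.ofReal (1 / (1 - r)) * K ^ r := by
  rcases eq_or_ne K 0 with rfl | hK0
  · rw [lintegral_rpow_eq_lintegral_meas_lt_mul μ (Filter.Eventually.of_forall hf0)
      hf.aemeasurable hr0]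
    have : ∫⁻ t in Ioi (0 : ℝ), μ {a : α | t < f a} * ENNReal.ofReal (t ^ (r - 1)) = 0 := by
      rw [setLIntegral_congr_fun (g := fun _ => 0) measurableSet_Ioi]
      · simp
      · intro t ht
        have h3 := h t ht
        have ht' : (0 : ℝ) < t := ht
        simp only [nonpos_iff_eq_zero, mul_eq_zero, ENNReal.ofReal_eq_zero, not_le.2 ht',
          false_or] at h3
        simp [h3]
    rw [this]
    simp
  · have e : ENNReal.ofReal K.toReal = K := ENNReal.ofReal_toReal hK
    rw [← e]
    exact kolm_real μ f hf hf0 r hr0 hr1 K.toReal (ENNReal.toReal_pos hK0 hK) (by rwa [e])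

theorem jens {α : Type*} [MeasurableSpace α] (μ : Measure α) [IsProbabilityMeasure μ]
    (g : α → ℝ≥0∞) (hg : Measurable g) (r : ℝ) (hr0 : 0 < r) (hr1 : r ≤ 1) :
    ∫⁻ x, g x ^ r ∂μ ≤ (∫⁻ x, g x ∂μ) ^ r := by
  have := eLpNorm'_le_eLpNorm'_mul_rpow_measure_univ (μ := μ) hr0 hr1 hg.aestronglyMeasurable
  simp only [eLpNorm', measure_univ, ENNReal.one_rpow, mul_one, enorm_eq_self, ENNReal.rpow_one,
    div_one] at this
  have h2 := ENNReal.rpow_le_rpow this hr0.le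
  rwa [← ENNReal.rpow_mul, one_div_mul_cancel hr0.ne', ENNReal.rpow_one] at h2

/-- Facts about cubes. -/
theorem cube_facts (n : ℕ) (Q : Set (Fin n → ℝ)) (hQ : IsCube n Q) :
    MeasurableSet Q ∧ volume Q ≠ 0 ∧ volume Q ≠ ∞ := by
  obtain ⟨a, h, hh, rfl⟩ := hQ
  refine ⟨MeasurableSet.univ_pi fun i => measurableSet_Icc, ?_, ?_⟩
  · rw [volume_pi_pi]
    simp [hh]
  · rw [volume_pi_pi]
    exact (ENNReal.prod_lt_top fun i _ => by simp).ne

theorem cube_main (n : ℕ) (p : ℝ) (hp : 1 < p)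
    (w : (Fin n → ℝ) → ℝ) (hwm : Measurable w) (hw0 : ∀ x, 0 ≤ w x)
    (hwpos : ∀ᵐ x ∂(volume : Measure (Fin n → ℝ)), 0 < w x)
    (hw : ApStarConst n p w < ∞) (s : ℝ) (hs : 1 < s)
    (Q : Set (Fin n → ℝ)) (hQ : IsCube n Q) :
    (∫⁻ x in Q, ENNReal.ofReal (w x ^ (1 / s)) < ∞) ∧
    ((volume Q)⁻¹ * ∫⁻ x in Q, ENNReal.ofReal (w x ^ (1 / s))) *
      ((volume Q)⁻¹ * ∫⁻ x in Q, ENNReal.ofReal ((w x ^ (1 / s)) ^ (1 - p / (p - 1)))) ^ (p - 1) ≤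
      ENNReal.ofReal (s / (s - 1)) * ApStarConst n p w ^ (1 / s) := by
  obtain ⟨hQm, hV0, hVt⟩ := cube_facts n Q hQ
  have hr0 : 0 < 1 / s := by positivity
  have hr1 : 1 / s < 1 := by rw [div_lt_one (by linarith)]; exact hs
  have hs' : 1 / (1 - 1 / s) = s / (s - 1) := by
    have : s - 1 ≠ 0 := by linarith
    field_simp
  generalize hr : 1 / s = r at *
  set ν : Measure (Fin n → ℝ) := (volume Q)⁻¹ • volume.restrict Q with hν
  have : IsProbabilityMeasure ν := by
    constructor
    simp [hν, ENNReal.inv_mul_cancel hV0 hVt]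
  have hav : ∀ g : (Fin n → ℝ) → ℝ≥0∞, (volume Q)⁻¹ * ∫⁻ x in Q, g x = ∫⁻ x, g x ∂ν := by
    intro g
    rw [hν, lintegral_smul_measure, smul_eq_mul]
  set N := wnormE n 1 (Q.indicator fun x => ENNReal.ofReal (w x)) with hN
  set K := (volume Q)⁻¹ * N with hK
  set q := 1 - p / (p - 1) with hq
  set σ := ∫⁻ x, ENNReal.ofReal (w x ^ q) ∂ν with hσ
  have hC : K * σ ^ (p - 1) ≤ ApStarConst n p w := by
    rw [hσ, ← hav]
    exact le_iSup₂ (f := fun (Q : Set (Fin n → ℝ)) (_ : IsCube n Q) =>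
      (volume Q)⁻¹ * wnormE n 1 (Q.indicator fun x => ENNReal.ofReal (w x)) *
      ((volume Q)⁻¹ * ∫⁻ x in Q, ENNReal.ofReal (w x ^ (1 - p / (p - 1)))) ^ (p - 1)) Q hQ
  have hνac : ν ≪ volume := by
    intro A hA
    have : volume.restrict Q A = 0 := Measure.restrict_le_self.absolutelyContinuous hA
    simp [hν, this]
  have hσ0 : σ ≠ 0 := by
    intro h0
    rw [hσ, lintegral_eq_zero_iff (by fun_prop)] at h0
    have : ∀ᵐ x ∂ν, False := by
      filter_upwards [h0, hνac.ae_le hwpos] with x hx hx'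
      have := Real.rpow_pos_of_pos hx' q
      simp only [Pi.zero_apply, ENNReal.ofReal_eq_zero] at hx
      linarith
    have h2 := Filter.eventually_false_iff_eq_bot.1 this
    exact (IsProbabilityMeasure.ne_zero ν) (ae_eq_bot.1 h2)
  have hKt : K ≠ ∞ := by
    intro hKt
    rw [hKt, ENNReal.top_mul] at hC
    · exact absurd (hC.trans_lt hw) (lt_irrefl _)
    · simp only [ne_eq, ENNReal.rpow_eq_zero_iff, not_or, not_and]
      exact ⟨fun h => absurd h hσ0, fun _ => by linarith⟩
  have hweak : ∀ t : ℝ, 0 < t → ENNReal.ofReal t * ν {x | t < w x} ≤ K := by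
    intro t ht
    have e : ν {x | t < w x} = (volume Q)⁻¹ * volume {x | ENNReal.ofReal t <
        Q.indicator (fun x => ENNReal.ofReal (w x)) x} := by
      rw [hν, Measure.smul_apply, smul_eq_mul, Measure.restrict_apply' hQm]
      congr 2
      ext x
      by_cases hx : x ∈ Q
      · simp [hx, ENNReal.ofReal_lt_ofReal_iff_of_nonneg ht.le]
      · simp [hx]
    rw [e, hK, mul_left_comm]
    gcongr
    have := le_iSup₂ (f := fun (t : ℝ) (_ : 0 < t) => ENNReal.ofReal t * volume {x |
      ENNReal.ofReal t < Q.indicator (fun x => ENNReal.ofReal (w x)) x} ^ (1 / (1 : ℝ))) t ht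
    simpa [hN, wnormE] using this
  have hk := kolm ν w hwm hw0 r hr0 hr1 K hKt hweak
  rw [hs'] at hk
  constructor
  · have hlt : ∫⁻ x, ENNReal.ofReal (w x ^ r) ∂ν < ∞ :=
      hk.trans_lt (ENNReal.mul_lt_top ENNReal.ofReal_lt_top (ENNReal.rpow_lt_top_of_nonneg hr0.le hKt))
    rw [← hav] at hlt
    by_contra hcon
    rw [not_lt, top_le_iff] at hcon
    rw [hcon, ENNReal.mul_top (ENNReal.inv_ne_zero.2 hVt)] at hlt
    exact lt_irrefl _ hlt
  · rw [hav, hav]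
    have hj : ∫⁻ x, ENNReal.ofReal ((w x ^ r) ^ q) ∂ν ≤ σ ^ r := by
      have := jens ν (fun x => ENNReal.ofReal (w x ^ q)) (by fun_prop) r hr0 hr1.le
      refine le_trans (le_of_eq ?_) this
      congr 1
      ext x
      rw [ENNReal.ofReal_rpow_of_nonneg (Real.rpow_nonneg (hw0 x) _) hr0.le,
        ← Real.rpow_mul (hw0 x), ← Real.rpow_mul (hw0 x), mul_comm]
    calc _ ≤ (ENNReal.ofReal (s / (s - 1)) * K ^ r) * (σ ^ r) ^ (p - 1) := by
          gcongr
      _ = ENNReal.ofReal (s / (s - 1)) * (K * σ ^ (p - 1)) ^ r := by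
          rw [ENNReal.mul_rpow_of_nonneg K _ hr0.le, ← ENNReal.rpow_mul, ← ENNReal.rpow_mul,
            mul_comm r, mul_assoc]
      _ ≤ _ := by gcongr


/-- If `w ∈ A_p^*` then for every `s > 1` the function `w^{1/s}` is locally
integrable, belongs to the Muckenhoupt class `A_p`, and satisfies
`[w^{1/s}]_{A_p} ≤ s'·[w]_{A_p^*}^{1/s}` with `s' = s/(s-1)`. -/
theorem statement6 (n : ℕ) (hn : 1 ≤ n) (p : ℝ) (hp : 1 < p)
    (w : (Fin n → ℝ) → ℝ) (hwm : Measurable w) (hw0 : ∀ x, 0 ≤ w x)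
    (hwpos : ∀ᵐ x ∂(volume : Measure (Fin n → ℝ)), 0 < w x)
    (hw : ApStarConst n p w < ∞) :
    ∀ s : ℝ, 1 < s →
      LocallyIntegrable (fun x => w x ^ (1 / s)) (volume : Measure (Fin n → ℝ)) ∧
      ApConst n p (fun x => w x ^ (1 / s)) < ∞ ∧
      ApConst n p (fun x => w x ^ (1 / s)) ≤
        ENNReal.ofReal (s / (s - 1)) * ApStarConst n p w ^ (1 / s) := by
  intro s hs
  have hle : ApConst n p (fun x => w x ^ (1 / s)) ≤
      ENNReal.ofReal (s / (s - 1)) * ApStarConst n p w ^ (1 / s) :=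
    iSup₂_le fun Q hQ => (cube_main n p hp w hwm hw0 hwpos hw s hs Q hQ).2
  refine ⟨?_, ?_, hle⟩
  · intro x
    let Q : Set (Fin n → ℝ) := Set.univ.pi fun i => Set.Icc (x i - 1) (x i - 1 + 2)
    have hQ : IsCube n Q := ⟨fun i => x i - 1, 2, by norm_num, rfl⟩
    refine ⟨Q, set_pi_mem_nhds finite_univ fun i _ => Icc_mem_nhds (by linarith) (by linarith), ?_⟩
    refine ⟨(hwm.pow_const _).aestronglyMeasurable, ?_⟩
    rw [hasFiniteIntegral_iff_ofReal
      (Filter.Eventually.of_forall fun y => Real.rpow_nonneg (hw0 y) _)]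
    exact (cube_main n p hp w hwm hw0 hwpos hw s hs Q hQ).1
  · exact hle.trans_lt (ENNReal.mul_lt_top ENNReal.ofReal_lt_top
      (ENNReal.rpow_lt_top_of_nonneg (by positivity) hw.ne))
end
end

section
/- Let n ≥ 1, 1 < p < ∞, and let w be a weight on ℝⁿ with w ∈ A_p^*, and set σ := w^{1−p'}. Then for every cube Q and every measurable subset E ⊆ Q with σ(E) > 0 and σ(Q) > 0, one has (|E|/|Q|)^{2p'} ≤ 4^{p'/p}·[w]_{A_p^*}^{p'−1}·(σ(E)/σ(Q)), where σ(A) := ∫_A σ dx. In particular, σ satisfies a reverse Hölder (A_∞-type) condition. -/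
open MeasureTheory Set
open scoped ENNReal

noncomputable section

/-- Kolmogorov's inequality for the square root. -/
lemma kolm_aux {α : Type*} [MeasurableSpace α] (μ : Measure α) (w : α → ℝ) (hwm : Measurable w)
    (hw0 : ∀ x, 0 ≤ w x) (A W : ℝ) (hA : 0 < A) (hW : 0 < W)
    (hμ : μ Set.univ ≤ ENNReal.ofReal A)
    (h : ∀ s : ℝ, 0 < s → μ {x | s < w x} ≤ ENNReal.ofReal (W / s)) :
    ∫⁻ x, ENNReal.ofReal (Real.sqrt (w x)) ∂μ ≤ ENNReal.ofReal (2 * Real.sqrt (W * A)) := by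
  rw [lintegral_eq_lintegral_meas_lt μ (Filter.Eventually.of_forall fun x => Real.sqrt_nonneg _)
    hwm.sqrt.aemeasurable]
  set T : ℝ := Real.sqrt (W / A) with hT
  have hTpos : 0 < T := Real.sqrt_pos.2 (div_pos hW hA)
  have hTT : T * T = W / A := Real.mul_self_sqrt (div_pos hW hA).le
  rw [← Set.Ioc_union_Ioi_eq_Ioi hTpos.le]
  refine (lintegral_union_le _ _ _).trans ?_
  have h1 : ∫⁻ t in Set.Ioc 0 T, μ {a | t < Real.sqrt (w a)} ≤ ENNReal.ofReal (A * T) := by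
    calc _ ≤ ∫⁻ t in Set.Ioc 0 T, ENNReal.ofReal A :=
          lintegral_mono fun t => (measure_mono (Set.subset_univ _)).trans hμ
      _ = _ := by
        rw [setLIntegral_const, Real.volume_Ioc, sub_zero, ENNReal.ofReal_mul hA.le]
  have h2 : ∫⁻ t in Set.Ioi T, μ {a | t < Real.sqrt (w a)} ≤ ENNReal.ofReal (W / T) := by
    calc _ ≤ ∫⁻ t in Set.Ioi T, ENNReal.ofReal (W * t ^ (-2 : ℝ)) := by
          refine setLIntegral_mono' measurableSet_Ioi fun t ht => ?_
          have ht0 : 0 < t := hTpos.trans ht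
          have := h (t ^ 2) (by positivity)
          have e : W * t ^ (-2 : ℝ) = W / t ^ 2 := by
            rw [Real.rpow_neg ht0.le, div_eq_mul_inv]; norm_num
          rw [e]
          refine le_trans (measure_mono ?_) this
          intro x hx
          exact (Real.lt_sqrt ht0.le).1 hx
      _ = _ := by
        rw [← ofReal_integral_eq_lintegral_ofReal]
        · rw [integral_const_mul, integral_Ioi_rpow_of_lt (by norm_num) hTpos]
          congr 1
          norm_num
          rw [Real.rpow_neg_one, div_eq_mul_inv]
        · exact (integrableOn_Ioi_rpow_of_lt (by norm_num) hTpos).const_mul W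
        · refine (ae_restrict_mem measurableSet_Ioi).mono fun t ht => ?_
          have ht0 : 0 < t := hTpos.trans ht
          positivity
  refine (add_le_add h1 h2).trans ?_
  rw [← ENNReal.ofReal_add (by positivity) (by positivity)]
  apply le_of_eq
  congr 1
  have e1 : W / T = A * T := by
    rw [div_eq_iff hTpos.ne', mul_assoc, hTT]; field_simp
  have e2 : A * T = Real.sqrt (W * A) := by
    symm
    rw [Real.sqrt_eq_iff_mul_self_eq (by positivity) (by positivity)]
    have e3 : A * T * (A * T) = W * A := by
      calc A * T * (A * T) = A * A * (T * T) := by ring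
        _ = _ := by rw [hTT]; field_simp
    first | exact e3 | exact e3.symm
  rw [e1, e2]; ring

/-- Hölder combined with Kolmogorov. -/
lemma holder_aux {α : Type*} [MeasurableSpace α] (μ : Measure α) (w : α → ℝ) (hwm : Measurable w)
    (hwpos : ∀ᵐ x ∂μ, 0 < w x) (p : ℝ) (hp : 1 < p) :
    μ Set.univ ≤ (∫⁻ x, ENNReal.ofReal (Real.sqrt (w x)) ∂μ) ^ (2 / (p + 1)) *
      (∫⁻ x, ENNReal.ofReal (w x ^ (1 - p / (p - 1))) ∂μ) ^ ((p - 1) / (p + 1)) := by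
  have hp1 : 0 < p - 1 := by linarith
  have hr : Real.HolderConjugate ((p + 1) / 2) ((p + 1) / (p - 1)) := by
    rw [Real.holderConjugate_iff]
    constructor
    · linarith
    · field_simp; ring
  have key := ENNReal.lintegral_mul_le_Lp_mul_Lq μ hr
    (f := fun x => ENNReal.ofReal (w x ^ (1 / (p + 1))))
    (g := fun x => ENNReal.ofReal (w x ^ (-(1 / (p + 1)))))
    (by fun_prop) (by fun_prop)
  have e0 : ∫⁻ x, ((fun x => ENNReal.ofReal (w x ^ (1 / (p + 1)))) *
      (fun x => ENNReal.ofReal (w x ^ (-(1 / (p + 1)))))) x ∂μ = μ Set.univ := by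
    rw [← lintegral_one]
    refine lintegral_congr_ae (hwpos.mono fun x hx => ?_)
    simp only [Pi.mul_apply]
    rw [← ENNReal.ofReal_mul (by positivity), ← Real.rpow_add hx]
    simp
  have e1 : ∫⁻ x, (ENNReal.ofReal (w x ^ (1 / (p + 1)))) ^ ((p + 1) / 2) ∂μ =
      ∫⁻ x, ENNReal.ofReal (Real.sqrt (w x)) ∂μ := by
    refine lintegral_congr_ae (hwpos.mono fun x hx => ?_)
    simp only
    rw [ENNReal.ofReal_rpow_of_pos (by positivity), ← Real.rpow_mul hx.le, Real.sqrt_eq_rpow]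
    congr 2
    field_simp
  have e2 : ∫⁻ x, (ENNReal.ofReal (w x ^ (-(1 / (p + 1))))) ^ ((p + 1) / (p - 1)) ∂μ =
      ∫⁻ x, ENNReal.ofReal (w x ^ (1 - p / (p - 1))) ∂μ := by
    refine lintegral_congr_ae (hwpos.mono fun x hx => ?_)
    simp only
    rw [ENNReal.ofReal_rpow_of_pos (by positivity), ← Real.rpow_mul hx.le]
    congr 2
    field_simp
    ring
  rw [e0, e1, e2] at key
  simpa only [one_div_div] using key

/-- The final real-number computation. -/
lemma real_aux (p a q W c s S : ℝ) (hp : 1 < p) (ha : 0 < a) (hq : 0 < q) (haq : a ≤ q)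
    (hW : 0 < W) (hs : 0 < s) (hS : 0 < S)
    (h1 : a ≤ (2 * Real.sqrt (W * a)) ^ (2 / (p + 1)) * s ^ ((p - 1) / (p + 1)))
    (h2 : q⁻¹ * W * (q⁻¹ * S) ^ (p - 1) ≤ c) :
    (a / q) ^ (2 * (p / (p - 1))) ≤ 4 ^ ((p / (p - 1)) / p) * c ^ (p / (p - 1) - 1) * (s / S) := by
  have hp1 : 0 < p - 1 := by linarith
  have hp2 : 0 < p + 1 := by linarith
  have h3 : a ^ (p + 1) ≤ 4 * W * a * s ^ (p - 1) := by
    have := Real.rpow_le_rpow ha.le h1 hp2.le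
    rw [Real.mul_rpow (by positivity) (by positivity), ← Real.rpow_mul (by positivity),
      ← Real.rpow_mul (by positivity), div_mul_cancel₀ _ hp2.ne', div_mul_cancel₀ _ hp2.ne'] at this
    have e : (2 * Real.sqrt (W * a)) ^ (2 : ℝ) = 4 * W * a := by
      rw [Real.rpow_two, mul_pow, Real.sq_sqrt (by positivity)]; ring
    rwa [e] at this
  have h4 : a ^ p ≤ 4 * W * s ^ (p - 1) := by
    rw [Real.rpow_add_one ha.ne'] at h3
    nlinarith [h3]
  have h2' : W * S ^ (p - 1) ≤ c * q ^ p := by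
    have e : q⁻¹ * W * (q⁻¹ * S) ^ (p - 1) = W * S ^ (p - 1) / q ^ p := by
      rw [Real.mul_rpow (by positivity) hS.le, Real.inv_rpow hq.le, Real.rpow_sub_one hq.ne']
      field_simp
    rw [e, div_le_iff₀ (by positivity)] at h2
    exact h2
  have hc : 0 < c := lt_of_lt_of_le (by positivity) h2
  have h5 : (a / q) ^ p ≤ 4 * c * (s / S) ^ (p - 1) := by
    rw [Real.div_rpow ha.le hq.le, Real.div_rpow hs.le hS.le, div_le_iff₀ (by positivity)]
    have hSp : 0 < S ^ (p - 1) := by positivity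
    have hsp : 0 < s ^ (p - 1) := by positivity
    rw [mul_div_assoc', div_mul_eq_mul_div, le_div_iff₀ hSp]
    calc a ^ p * S ^ (p - 1) ≤ 4 * W * s ^ (p - 1) * S ^ (p - 1) := by gcongr
      _ = 4 * s ^ (p - 1) * (W * S ^ (p - 1)) := by ring
      _ ≤ 4 * s ^ (p - 1) * (c * q ^ p) := by gcongr
      _ = _ := by ring
  have h6 := Real.rpow_le_rpow (by positivity) h5 (z := 1 / (p - 1)) (by positivity)
  rw [← Real.rpow_mul (by positivity), Real.mul_rpow (by positivity) (by positivity),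
    Real.mul_rpow (by positivity) (by positivity), ← Real.rpow_mul (by positivity),
    mul_one_div_cancel hp1.ne', Real.rpow_one] at h6
  have e1 : p / (p - 1) / p = 1 / (p - 1) := by field_simp
  have e2 : p / (p - 1) - 1 = 1 / (p - 1) := by field_simp; ring
  rw [e1, e2]
  refine le_trans ?_ h6
  apply Real.rpow_le_rpow_of_exponent_ge (by positivity) ((div_le_one hq).2 haq)
  rw [mul_one_div]
  have : 0 < p / (p - 1) := by positivity
  linarith

/-- If `w ∈ A_p^*` and `σ = w^{1-p'}`, then for every cube `Q` and every
measurable `E ⊆ Q` with `σ(E), σ(Q) > 0`,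
`(|E|/|Q|)^{2p'} ≤ 4^{p'/p}·[w]_{A_p^*}^{p'-1}·(σ(E)/σ(Q))`. -/
theorem statement7 (n : ℕ) (hn : 1 ≤ n) (p : ℝ) (hp : 1 < p)
    (w : (Fin n → ℝ) → ℝ) (hwm : Measurable w) (hw0 : ∀ x, 0 ≤ w x)
    (hwpos : ∀ᵐ x ∂(volume : Measure (Fin n → ℝ)), 0 < w x)
    (hw : ApStarConst n p w < ∞) :
    ∀ Q : Set (Fin n → ℝ), IsCube n Q →
      ∀ E : Set (Fin n → ℝ), MeasurableSet E → E ⊆ Q →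
        0 < (∫⁻ x in E, ENNReal.ofReal (w x ^ (1 - p / (p - 1)))) →
        0 < (∫⁻ x in Q, ENNReal.ofReal (w x ^ (1 - p / (p - 1)))) →
        (volume E / volume Q) ^ (2 * (p / (p - 1))) ≤
          ENNReal.ofReal ((4 : ℝ) ^ ((p / (p - 1)) / p)) *
            ApStarConst n p w ^ (p / (p - 1) - 1) *
            ((∫⁻ x in E, ENNReal.ofReal (w x ^ (1 - p / (p - 1)))) /
              (∫⁻ x in Q, ENNReal.ofReal (w x ^ (1 - p / (p - 1))))) := by
  intro Q hQ E hE hEQ hσE hσQ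
  have hp1 : 0 < p - 1 := by linarith
  have hpp : 0 < p / (p - 1) := by positivity
  have hmono : (∫⁻ x in E, ENNReal.ofReal (w x ^ (1 - p / (p - 1)))) ≤
      (∫⁻ x in Q, ENNReal.ofReal (w x ^ (1 - p / (p - 1)))) := lintegral_mono_set hEQ
  have hQC : (volume Q)⁻¹ * wnormE n 1 (Q.indicator fun x => ENNReal.ofReal (w x)) *
      ((volume Q)⁻¹ * ∫⁻ x in Q, ENNReal.ofReal (w x ^ (1 - p / (p - 1)))) ^ (p - 1)
      ≤ ApStarConst n p w := le_iSup₂_of_le Q hQ le_rfl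
  have hvE : volume E ≤ volume Q := measure_mono hEQ
  have hhol := holder_aux (volume.restrict E) w hwm (ae_restrict_of_ae hwpos) p hp
  have hvQ : volume Q ≠ 0 ∧ volume Q ≠ ∞ := by
    obtain ⟨a, h, hh, rfl⟩ := hQ
    rw [volume_pi_pi]
    simp [hh]
  obtain ⟨hQ0, hQt⟩ := hvQ
  have hdist : ∀ s : ℝ, 0 < s → ENNReal.ofReal s * (volume.restrict E) {x | s < w x} ≤
      wnormE n 1 (Q.indicator fun x => ENNReal.ofReal (w x)) := by
    intro s hs
    refine le_trans ?_ (le_iSup₂_of_le s hs le_rfl)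
    rw [div_one, ENNReal.rpow_one]
    refine mul_le_mul_right ?_ _
    rw [Measure.restrict_apply (measurableSet_lt measurable_const hwm)]
    apply measure_mono
    rintro x ⟨hx, hxE⟩
    simp only [Set.mem_setOf_eq] at hx ⊢
    rw [Set.indicator_of_mem (hEQ hxE)]
    exact (ENNReal.ofReal_lt_ofReal_iff (hs.trans hx)).2 hx
  set C := ApStarConst n p w
  set W := wnormE n 1 (Q.indicator fun x => ENNReal.ofReal (w x))
  set σE := ∫⁻ x in E, ENNReal.ofReal (w x ^ (1 - p / (p - 1)))
  set σQ := ∫⁻ x in Q, ENNReal.ofReal (w x ^ (1 - p / (p - 1)))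
  rcases eq_or_ne (volume E) 0 with hE0 | hE0
  · rw [hE0, ENNReal.zero_div, ENNReal.zero_rpow_of_pos (by positivity)]
    exact zero_le
  have hEt : volume E ≠ ∞ := ne_top_of_le_ne_top hQt hvE
  have hW0 : W ≠ 0 := by
    intro hW0
    apply hE0
    have hz : ∀ k : ℕ, (volume.restrict E) {x | 1 / ((k : ℝ) + 1) < w x} = 0 := by
      intro k
      have hk : (0 : ℝ) < 1 / ((k : ℝ) + 1) := by positivity
      have := hdist _ hk
      rw [hW0, nonpos_iff_eq_zero, mul_eq_zero] at this
      rcases this with h | h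
      · exact absurd h (ENNReal.ofReal_pos.2 hk).ne'
      · exact h
    have hU := measure_iUnion_null hz
    have : (volume.restrict E) Set.univ = 0 := by
      have h0 : (volume.restrict E) {x | ¬ 0 < w x} = 0 := ae_iff.1 (ae_restrict_of_ae hwpos)
      refine measure_mono_null ?_ (measure_union_null hU h0)
      intro x _
      by_cases hx : 0 < w x
      · left
        obtain ⟨k, hk⟩ := exists_nat_one_div_lt hx
        exact Set.mem_iUnion.2 ⟨k, hk⟩
      · exact Or.inr hx
    simpa using this
  have hi0 : (volume Q)⁻¹ ≠ 0 := ENNReal.inv_ne_zero.2 hQt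
  have hit : (volume Q)⁻¹ ≠ ∞ := ENNReal.inv_ne_top.2 hQ0
  have hlt := ne_top_of_le_ne_top hw.ne hQC
  have hσQt : σQ ≠ ∞ := by
    intro h
    apply hlt
    rw [h, ENNReal.mul_top hi0, ENNReal.top_rpow_of_pos hp1]
    exact ENNReal.mul_top (mul_ne_zero hi0 hW0)
  have hWt : W ≠ ∞ := by
    intro h
    apply hlt
    rw [h, ENNReal.mul_top hi0]
    refine ENNReal.top_mul ?_
    exact (ENNReal.rpow_pos (pos_iff_ne_zero.2 (mul_ne_zero hi0 hσQ.ne'))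
      (ENNReal.mul_ne_top hit hσQt)).ne'
  have hσEt : σE ≠ ∞ := ne_top_of_le_ne_top hσQt hmono
  have ha : 0 < (volume E).toReal := ENNReal.toReal_pos hE0 hEt
  have hq : 0 < (volume Q).toReal := ENNReal.toReal_pos hQ0 hQt
  have hWp : 0 < W.toReal := ENNReal.toReal_pos hW0 hWt
  have hs : 0 < σE.toReal := ENNReal.toReal_pos hσE.ne' hσEt
  have hS : 0 < σQ.toReal := ENNReal.toReal_pos hσQ.ne' hσQt
  have hk := kolm_aux (volume.restrict E) w hwm hw0 (volume E).toReal W.toReal ha hWp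
    (by rw [ENNReal.ofReal_toReal hEt]; simp) (by
      intro s hs
      rw [ENNReal.ofReal_div_of_pos hs, ENNReal.ofReal_toReal hWt]
      rw [ENNReal.le_div_iff_mul_le (Or.inl (ENNReal.ofReal_pos.2 hs).ne')
        (Or.inl ENNReal.ofReal_ne_top), mul_comm]
      exact hdist s hs)
  have h1 : (volume E).toReal ≤ (2 * Real.sqrt (W.toReal * (volume E).toReal)) ^ (2 / (p + 1)) *
      σE.toReal ^ ((p - 1) / (p + 1)) := by
    have hb : volume E ≤ ENNReal.ofReal ((2 * Real.sqrt (W.toReal * (volume E).toReal)) ^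
        (2 / (p + 1)) * σE.toReal ^ ((p - 1) / (p + 1))) := by
      rw [ENNReal.ofReal_mul (by positivity), ← ENNReal.ofReal_rpow_of_pos (by positivity),
        ← ENNReal.ofReal_rpow_of_pos hs, ENNReal.ofReal_toReal hσEt]
      rw [Measure.restrict_apply_univ] at hhol
      refine hhol.trans ?_
      gcongr
    exact ENNReal.toReal_le_of_le_ofReal (by positivity) hb
  have h2 : (volume Q).toReal⁻¹ * W.toReal * ((volume Q).toReal⁻¹ * σQ.toReal) ^ (p - 1)
      ≤ C.toReal := by
    have := ENNReal.toReal_mono hw.ne hQC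
    simpa only [ENNReal.toReal_mul, ENNReal.toReal_inv, ← ENNReal.toReal_rpow] using this
  have hfin := real_aux p _ _ _ _ _ _ hp ha hq (ENNReal.toReal_mono hQt hvE) hWp hs hS h1 h2
  have hC : 0 < C.toReal := lt_of_lt_of_le (by positivity) h2
  have := ENNReal.ofReal_le_ofReal hfin
  rw [ENNReal.ofReal_mul (by positivity), ENNReal.ofReal_mul (by positivity),
    ← ENNReal.ofReal_rpow_of_pos (by positivity), ← ENNReal.ofReal_rpow_of_pos hC,
    ENNReal.ofReal_div_of_pos hq, ENNReal.ofReal_div_of_pos hS, ENNReal.ofReal_toReal hEt,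
    ENNReal.ofReal_toReal hQt, ENNReal.ofReal_toReal hw.ne, ENNReal.ofReal_toReal hσEt,
    ENNReal.ofReal_toReal hσQt] at this
  exact this
end
end

section
/- Let n ≥ 1, 1 < p < ∞, s > 1, and let w be a weight on ℝⁿ with w ∈ A_p^*, and set σ := w^{1−p'}. Then for every cube Q and every measurable subset E ⊆ Q with σ(E) > 0 and σ(Q) > 0, one has (|E|/|Q|)^{s p'} ≤ [w]_{A_p^*}^{p'−1}·(s')^{s p'/p}·(σ(E)/σ(Q)), where s' = s/(s−1) and σ(A) := ∫_A σ dx. -/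
open MeasureTheory Set
open scoped ENNReal

noncomputable section

theorem real_const (p s : ℝ) (hp : 1 < p) (hs : 1 < s) :
    p / (p - 1) ≤ (s / (s - 1)) ^ (s * (p / (p - 1)) / p) := by
  have hp1 : 0 < p - 1 := by linarith
  have hs1 : 0 < s - 1 := by linarith
  have hs' : 0 < s / (s - 1) := by positivity
  have hp' : 0 < p / (p - 1) := by positivity
  rw [← Real.log_le_log_iff hp' (Real.rpow_pos_of_pos hs' _), Real.log_rpow hs']
  have h1 := Real.log_le_sub_one_of_pos hp'
  have h2 := Real.one_sub_inv_le_log_of_pos hs'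
  have h3 : s * (p / (p - 1)) / p * (1 - (s / (s - 1))⁻¹) = p / (p - 1) - 1 := by
    field_simp
    ring
  have h4 : 0 ≤ s * (p / (p - 1)) / p := by positivity
  nlinarith [mul_le_mul_of_nonneg_left h2 h4]

theorem real_final (p s e q W A sE sQ : ℝ) (hp : 1 < p) (hs : 1 < s) (he : 0 < e) (hq : 0 < q)
    (heq : e ≤ q) (hW : 0 < W) (hsE : 0 < sE) (hsQ : 0 < sQ) 
    (h1 : (e / W) ^ (1 / (p - 1)) * e * (1 - 1 / p) ≤ sE)
    (h2 : q⁻¹ * W * (q⁻¹ * sQ) ^ (p - 1) ≤ A) :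
    (e / q) ^ (s * (p / (p - 1))) ≤
      A ^ (p / (p - 1) - 1) * (s / (s - 1)) ^ (s * (p / (p - 1)) / p) * (sE / sQ) := by
  have hp1 : 0 < p - 1 := by linarith
  have hr : p / (p - 1) - 1 = 1 / (p - 1) := by field_simp; ring
  have hr' : p / (p - 1) = 1 + 1 / (p - 1) := by linarith
  have hr0 : 0 < 1 / (p - 1) := by positivity
  have hc := real_const p s hp hs
  have hA : 0 < A := lt_of_lt_of_le (by positivity) h2
  have step1 : (e / q) ^ (s * (p / (p - 1))) ≤ (e / q) ^ (p / (p - 1)) := by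
    apply Real.rpow_le_rpow_of_exponent_ge (by positivity)
    · rw [div_le_one hq]; exact heq
    · have : 0 < p / (p - 1) := by positivity
      nlinarith
  have step2 : (W / q) ^ (1 / (p - 1)) * (sQ / q) ≤ A ^ (1 / (p - 1)) := by
    have := Real.rpow_le_rpow (by positivity) h2 hr0.le
    rw [Real.mul_rpow (by positivity) (by positivity), ← Real.rpow_mul (by positivity),
      mul_one_div_cancel hp1.ne', Real.rpow_one] at this
    rw [div_eq_inv_mul W, div_eq_inv_mul sQ]
    exact this
  rw [hr]
  refine step1.trans ?_
  calc (e / q) ^ (p / (p - 1))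
      = (p / (p - 1)) * ((W / q) ^ (1 / (p - 1)) * (sQ / q)) *
          (((e / W) ^ (1 / (p - 1)) * e * (1 - 1 / p)) / sQ) := by
        rw [hr', Real.rpow_add (by positivity), Real.rpow_one, ← hr']
        have : (e / q) ^ (1 / (p - 1)) = (e / W) ^ (1 / (p - 1)) * (W / q) ^ (1 / (p - 1)) := by
          rw [← Real.mul_rpow (by positivity) (by positivity)]
          congr 1
          field_simp
        rw [this]
        generalize (e / W) ^ (1 / (p - 1)) = X
        generalize (W / q) ^ (1 / (p - 1)) = Y
        field_simp
    _ ≤ (s / (s - 1)) ^ (s * (p / (p - 1)) / p) * A ^ (1 / (p - 1)) * (sE / sQ) := by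
        have : 0 ≤ 1 - 1 / p := by
          have : 1 / p ≤ 1 := by rw [div_le_one (by linarith)]; exact hp.le
          linarith
        have : 0 < s - 1 := by linarith
        gcongr
    _ = _ := by ring

theorem layer (n : ℕ) (p : ℝ) (hp : 1 < p) 
    (w : (Fin n → ℝ) → ℝ) (hwm : Measurable w) (hw0 : ∀ x, 0 ≤ w x)
    (hwpos : ∀ᵐ x ∂(volume : Measure (Fin n → ℝ)), 0 < w x)
    (Q E : Set (Fin n → ℝ)) (hE : MeasurableSet E) (hEQ : E ⊆ Q) (e W : ℝ) (he : 0 < e)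
    (hW : 0 < W) (hve : volume E = ENNReal.ofReal e)
    (hWQ : wnormE n 1 (Q.indicator fun x => ENNReal.ofReal (w x)) ≤ ENNReal.ofReal W) :
    ENNReal.ofReal ((e / W) ^ (1 / (p - 1)) * e * (1 - 1 / p)) ≤
      ∫⁻ x in E, ENNReal.ofReal (w x ^ (1 - p / (p - 1))) := by
  have hp1 : 0 < p - 1 := by linarith
  have hr : 1 - p / (p - 1) = - (1 / (p - 1)) := by field_simp; ring
  have hr0 : 0 < 1 / (p - 1) := by positivity
  rw [hr]
  set U := (e / W) ^ (1 / (p - 1)) with hU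
  have hU0 : 0 < U := by positivity
  have key : ∀ t : ℝ, 0 < t → ENNReal.ofReal (e - W * t ^ (p - 1)) ≤
      (volume.restrict E) {x | t ≤ w x ^ (-(1 / (p - 1)))} := by
    intro t ht
    have hms : MeasurableSet {x | t ≤ w x ^ (-(1 / (p - 1)))} :=
      measurableSet_le measurable_const (hwm.pow_const _)
    rw [Measure.restrict_apply hms]
    set τ := t ^ (-(p - 1)) with hτ
    have hτ0 : 0 < τ := by positivity
    have hchev : ENNReal.ofReal τ * volume {x | x ∈ Q ∧ τ < w x} ≤ ENNReal.ofReal W := by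
      refine le_trans ?_ hWQ
      refine le_trans ?_ (le_iSup₂ (f := fun (t : ℝ) (_ : 0 < t) => ENNReal.ofReal t *
        volume {x | ENNReal.ofReal t < (Q.indicator fun x => ENNReal.ofReal (w x)) x} ^ (1 / (1:ℝ)))
        τ hτ0)
      simp only [div_one, ENNReal.rpow_one]
      refine mul_le_mul_right (measure_mono ?_) _
      rintro x ⟨hx, hx2⟩
      rw [mem_setOf_eq]
      rw [indicator_of_mem hx]
      exact (ENNReal.ofReal_lt_ofReal_iff (hτ0.trans hx2)).2 hx2
    have hbad : volume {x | x ∈ Q ∧ τ < w x} ≤ ENNReal.ofReal (W * t ^ (p - 1)) := by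
      have : W * t ^ (p - 1) = τ⁻¹ * W := by
        rw [hτ, Real.rpow_neg ht.le, inv_inv, mul_comm]
      rw [this, ENNReal.ofReal_mul (by positivity), ENNReal.ofReal_inv_of_pos hτ0]
      rw [← ENNReal.div_eq_inv_mul]
      rw [ENNReal.le_div_iff_mul_le (Or.inl (by simpa using hτ0)) (Or.inl ENNReal.ofReal_ne_top),
        mul_comm]
      exact hchev
    rw [ENNReal.ofReal_sub _ (by positivity), tsub_le_iff_right, ← hve]
    have hnull : volume {x | ¬ 0 < w x} = 0 := hwpos
    calc volume E ≤ volume (({x | t ≤ w x ^ (-(1 / (p - 1)))} ∩ E) ∪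
          ({x | x ∈ Q ∧ τ < w x} ∪ {x | ¬ 0 < w x})) := by
          apply measure_mono
          intro x hx
          by_cases h1 : 0 < w x
          swap
          · exact Or.inr (Or.inr h1)
          by_cases h2 : τ < w x
          · exact Or.inr (Or.inl ⟨hEQ hx, h2⟩)
          refine Or.inl ⟨?_, hx⟩
          show t ≤ _
          push Not at h2
          have h3 := Real.rpow_le_rpow_of_nonpos h1 h2 (z := -(1 / (p - 1))) (by linarith)
          rwa [hτ, ← Real.rpow_mul ht.le, neg_mul_neg, mul_one_div_cancel hp1.ne',
            Real.rpow_one] at h3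
      _ ≤ _ + (_ + _) := (measure_union_le _ _).trans (by gcongr; exact measure_union_le _ _)
      _ ≤ _ := by rw [hnull, add_zero]; gcongr
  rw [lintegral_eq_lintegral_meas_le (volume.restrict E)
    (Filter.Eventually.of_forall fun x => Real.rpow_nonneg (hw0 x) _)
    (hwm.pow_const _).aemeasurable]
  have hUp : U ^ (p - 1) = e / W := by
    rw [hU, ← Real.rpow_mul (by positivity), one_div_mul_cancel hp1.ne', Real.rpow_one]
  have hii : IntervalIntegrable (fun t : ℝ => e - W * t ^ (p - 1)) volume 0 U :=
    intervalIntegrable_const.sub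
      ((intervalIntegral.intervalIntegrable_rpow' (by linarith)).const_mul _)
  have hint : ∫ t in Ioc 0 U, (e - W * t ^ (p - 1)) = U * e * (1 - 1 / p) := by
    rw [← intervalIntegral.integral_of_le hU0.le, intervalIntegral.integral_sub
      intervalIntegrable_const
      ((intervalIntegral.intervalIntegrable_rpow' (by linarith)).const_mul _),
      intervalIntegral.integral_const_mul, integral_rpow (Or.inl (by linarith))]
    have : U ^ (p - 1 + 1) = e / W * U := by rw [Real.rpow_add hU0, hUp, Real.rpow_one]
    rw [this, Real.zero_rpow (by linarith)]
    simp
    field_simp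
  rw [← hint, ofReal_integral_eq_lintegral_ofReal hii.1]
  · calc _ ≤ ∫⁻ t in Ioc 0 U, (volume.restrict E) {x | t ≤ w x ^ (-(1 / (p - 1)))} :=
          setLIntegral_mono' measurableSet_Ioc fun t ht => key t ht.1
      _ ≤ _ := lintegral_mono_set fun t ht => ht.1
  · refine (ae_restrict_iff' measurableSet_Ioc).2 (Filter.Eventually.of_forall fun t ht => ?_)
    have := Real.rpow_le_rpow ht.1.le ht.2 hp1.le
    rw [hUp, le_div_iff₀ hW] at this
    simp only [Pi.zero_apply]
    linarith

theorem cube_vol (n : ℕ) (Q : Set (Fin n → ℝ)) (h : IsCube n Q) :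
    MeasurableSet Q ∧ volume Q ≠ 0 ∧ volume Q ≠ ∞ := by
  obtain ⟨a, h, hh, rfl⟩ := h
  refine ⟨MeasurableSet.univ_pi fun i => measurableSet_Icc, ?_, ?_⟩
  · rw [volume_pi_pi, Finset.prod_ne_zero_iff]
    intro i _
    simpa using hh
  · rw [volume_pi_pi]
    exact ENNReal.prod_ne_top fun i _ => by simp

theorem wnorm_ne_zero (n : ℕ) (w : (Fin n → ℝ) → ℝ)
    (hwpos : ∀ᵐ x ∂(volume : Measure (Fin n → ℝ)), 0 < w x)
    (Q : Set (Fin n → ℝ)) (hQ : volume Q ≠ 0) :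
    wnormE n 1 (Q.indicator fun x => ENNReal.ofReal (w x)) ≠ 0 := by
  intro h0
  apply hQ
  have hz : ∀ k : ℕ, volume {x | x ∈ Q ∧ 1 / ((k : ℝ) + 1) < w x} = 0 := by
    intro k
    have hk : (0 : ℝ) < 1 / ((k : ℝ) + 1) := by positivity
    have h1 := (le_iSup₂ (f := fun (t : ℝ) (_ : 0 < t) => ENNReal.ofReal t *
        volume {x | ENNReal.ofReal t < (Q.indicator fun x => ENNReal.ofReal (w x)) x} ^ (1 / (1:ℝ)))
        _ hk).trans h0.le
    simp only [div_one, ENNReal.rpow_one, nonpos_iff_eq_zero, mul_eq_zero] at h1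
    rcases h1 with h1 | h1
    · rw [ENNReal.ofReal_eq_zero] at h1
      linarith
    · refine measure_mono_null ?_ h1
      rintro x ⟨hx, hx2⟩
      rw [mem_setOf_eq]
      rw [indicator_of_mem hx]
      exact (ENNReal.ofReal_lt_ofReal_iff (hk.trans hx2)).2 hx2
  have hnull : volume {x | ¬ 0 < w x} = 0 := hwpos
  refine measure_mono_null ?_ (measure_union_null hnull (measure_iUnion_null hz))
  intro x hx
  by_cases h1 : 0 < w x
  · obtain ⟨k, hk⟩ := exists_nat_one_div_lt h1
    exact Or.inr (mem_iUnion.2 ⟨k, hx, hk⟩)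
  · exact Or.inl h1

/-- If `w ∈ A_p^*`, `s > 1` and `σ = w^{1-p'}`, then for every cube `Q` and
every measurable `E ⊆ Q` with `σ(E), σ(Q) > 0`,
`(|E|/|Q|)^{sp'} ≤ [w]_{A_p^*}^{p'-1}·(s')^{sp'/p}·(σ(E)/σ(Q))` with `s' = s/(s-1)`. -/
theorem statement8 (n : ℕ) (hn : 1 ≤ n) (p : ℝ) (hp : 1 < p) (s : ℝ) (hs : 1 < s)
    (w : (Fin n → ℝ) → ℝ) (hwm : Measurable w) (hw0 : ∀ x, 0 ≤ w x)
    (hwpos : ∀ᵐ x ∂(volume : Measure (Fin n → ℝ)), 0 < w x)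
    (hw : ApStarConst n p w < ∞) :
    ∀ Q : Set (Fin n → ℝ), IsCube n Q →
      ∀ E : Set (Fin n → ℝ), MeasurableSet E → E ⊆ Q →
        0 < (∫⁻ x in E, ENNReal.ofReal (w x ^ (1 - p / (p - 1)))) →
        0 < (∫⁻ x in Q, ENNReal.ofReal (w x ^ (1 - p / (p - 1)))) →
        (volume E / volume Q) ^ (s * (p / (p - 1))) ≤
          ApStarConst n p w ^ (p / (p - 1) - 1) *
            ENNReal.ofReal ((s / (s - 1)) ^ (s * (p / (p - 1)) / p)) *
            ((∫⁻ x in E, ENNReal.ofReal (w x ^ (1 - p / (p - 1)))) /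
              (∫⁻ x in Q, ENNReal.ofReal (w x ^ (1 - p / (p - 1))))) := by
  intro Q hQ E hE hEQ hsE hsQ
  obtain ⟨-, hQ0, hQt⟩ := cube_vol n Q hQ
  have hW0 := wnorm_ne_zero n w hwpos Q hQ0
  have hp1 : 0 < p - 1 := by linarith
  have hbd : (volume Q)⁻¹ * wnormE n 1 (Q.indicator fun x => ENNReal.ofReal (w x)) *
      ((volume Q)⁻¹ * ∫⁻ x in Q, ENNReal.ofReal (w x ^ (1 - p / (p - 1)))) ^ (p - 1)
      ≤ ApStarConst n p w :=
    le_iSup₂ (f := fun (Q : Set (Fin n → ℝ)) (_ : IsCube n Q) =>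
      (volume Q)⁻¹ * wnormE n 1 (Q.indicator fun x => ENNReal.ofReal (w x)) *
      ((volume Q)⁻¹ * ∫⁻ x in Q, ENNReal.ofReal (w x ^ (1 - p / (p - 1)))) ^ (p - 1)) Q hQ
  have hEle : (∫⁻ x in E, ENNReal.ofReal (w x ^ (1 - p / (p - 1)))) ≤
      ∫⁻ x in Q, ENNReal.ofReal (w x ^ (1 - p / (p - 1))) := lintegral_mono_set hEQ
  have hE0 : volume E ≠ 0 := by
    intro h
    rw [Measure.restrict_eq_zero.2 h] at hsE
    simp at hsE
  have hvle : volume E ≤ volume Q := measure_mono hEQ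
  have hlay := layer n p hp w hwm hw0 hwpos Q E hE hEQ
  generalize wnormE n 1 (Q.indicator fun x => ENNReal.ofReal (w x)) = W at *
  generalize ApStarConst n p w = A at *
  generalize (∫⁻ x in Q, ENNReal.ofReal (w x ^ (1 - p / (p - 1)))) = sQ at *
  generalize (∫⁻ x in E, ENNReal.ofReal (w x ^ (1 - p / (p - 1)))) = sE at *
  generalize volume Q = q at *
  generalize volume E = e at *
  have hqi0 : q⁻¹ ≠ 0 := ENNReal.inv_ne_zero.2 hQt
  have hqit : q⁻¹ ≠ ∞ := ENNReal.inv_ne_top.2 hQ0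
  have hprod := ne_top_of_le_ne_top hw.ne hbd
  have hsQt : sQ ≠ ∞ := by
    rintro rfl
    apply hprod
    rw [ENNReal.mul_top hqi0, ENNReal.top_rpow_of_pos hp1, ENNReal.mul_top (mul_ne_zero hqi0 hW0)]
  have hWt : W ≠ ∞ := by
    rintro rfl
    apply hprod
    rw [ENNReal.mul_top hqi0, ENNReal.top_mul]
    have := (ENNReal.rpow_pos (pos_iff_ne_zero.2 (mul_ne_zero hqi0 hsQ.ne'))
      (ENNReal.mul_ne_top hqit hsQt) (p := p - 1))
    exact this.ne'
  have hsEt : sE ≠ ∞ := ne_top_of_le_ne_top hsQt hEle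
  have het : e ≠ ∞ := ne_top_of_le_ne_top hQt hvle
  have hAt := hw.ne
  have he' := ENNReal.toReal_pos hE0 het
  have hq' := ENNReal.toReal_pos hQ0 hQt
  have hW' := ENNReal.toReal_pos hW0 hWt
  have hsE' := ENNReal.toReal_pos hsE.ne' hsEt
  have hsQ' := ENNReal.toReal_pos hsQ.ne' hsQt
  have l1 := hlay e.toReal W.toReal he' hW' (ENNReal.ofReal_toReal het).symm
    (ENNReal.ofReal_toReal hWt).ge
  have l2 := (ENNReal.ofReal_le_iff_le_toReal hsEt).1 l1
  have l3 := ENNReal.toReal_mono hAt hbd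
  simp only [ENNReal.toReal_mul, ENNReal.toReal_inv, ← ENNReal.toReal_rpow] at l3
  have fin := real_final p s _ _ _ _ _ _ hp hs he' hq' (ENNReal.toReal_mono hQt hvle) hW' hsE' hsQ'
    l2 l3
  have hs1 : 0 < s - 1 := by linarith
  have hr0 : 0 ≤ p / (p - 1) - 1 := by
    have hr : p / (p - 1) - 1 = 1 / (p - 1) := by field_simp; ring
    rw [hr]; positivity
  have hex : 0 ≤ s * (p / (p - 1)) := by positivity
  rw [← ENNReal.toReal_le_toReal]
  · simp only [ENNReal.toReal_mul, ENNReal.toReal_div, ← ENNReal.toReal_rpow]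
    rw [ENNReal.toReal_ofReal (by positivity)]
    exact fin
  · exact ENNReal.rpow_ne_top_of_nonneg hex (ENNReal.div_ne_top het hQ0)
  · exact ENNReal.mul_ne_top (ENNReal.mul_ne_top (ENNReal.rpow_ne_top_of_nonneg hr0 hAt)
      ENNReal.ofReal_ne_top) (ENNReal.div_ne_top hsEt hsQ.ne')
end
end

section
/- Let n ≥ 1, 1 < p ≤ q < ∞, and let w be a weight on ℝⁿ with w ∈ A_{p,q}^*, and set σ := w^{−p'}. Then for every cube Q and every measurable subset E ⊆ Q with σ(E) > 0 and σ(Q) > 0, one has (|E|/|Q|)^{2p'} ≤ 4^{p'/q}·[w]_{A_{p,q}^*}^{p'}·(σ(E)/σ(Q)), where σ(A) := ∫_A σ dx. In particular, σ satisfies a reverse Hölder (A_∞-type) condition. -/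
open MeasureTheory Set
open scoped ENNReal

noncomputable section

lemma aux_kolm {α : Type*} [MeasurableSpace α] (μ : Measure α) [IsFiniteMeasure μ] (v : α → ℝ)
    (hv : Measurable v) (hv0 : ∀ x, 0 ≤ v x) (N m : ℝ) (hN : 0 < N) (hm : 0 < m)
    (hμ : μ univ = ENNReal.ofReal m)
    (h : ∀ s : ℝ, 0 < s → μ {x | s < v x} ≤ ENNReal.ofReal (N * s ^ (-2 : ℝ))) :
    ∫⁻ x, ENNReal.ofReal (v x) ∂μ ≤ ENNReal.ofReal ((4 * N * m) ^ (1 / 2 : ℝ)) := by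
  rw [lintegral_eq_lintegral_meas_lt μ (Filter.Eventually.of_forall hv0) hv.aemeasurable]
  set T : ℝ := Real.sqrt (N / m) with hT
  have hT0 : 0 < T := Real.sqrt_pos.2 (by positivity)
  have hT2 : T ^ 2 = N / m := Real.sq_sqrt (by positivity)
  rw [← Ioc_union_Ioi_eq_Ioi hT0.le]
  refine (lintegral_union_le _ _ _).trans ?_
  have h1 : ∫⁻ t in Ioc 0 T, μ {x | t < v x} ≤ ENNReal.ofReal (m * T) := by
    calc _ ≤ ∫⁻ t in Ioc 0 T, ENNReal.ofReal m :=
          lintegral_mono fun t => by rw [← hμ]; exact measure_mono (subset_univ _)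
      _ = _ := by
          rw [setLIntegral_const, Real.volume_Ioc, sub_zero, ← ENNReal.ofReal_mul hm.le]
  have h2 : ∫⁻ t in Ioi T, μ {x | t < v x} ≤ ENNReal.ofReal (N / T) := by
    calc _ ≤ ∫⁻ t in Ioi T, ENNReal.ofReal (N * t ^ (-2 : ℝ)) :=
          setLIntegral_mono' measurableSet_Ioi fun t ht => h t (hT0.trans ht)
      _ = ENNReal.ofReal (∫ t in Ioi T, N * t ^ (-2 : ℝ)) := by
          rw [ofReal_integral_eq_lintegral_ofReal]
          · exact ((integrableOn_Ioi_rpow_of_lt (by norm_num) hT0).const_mul N)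
          · refine (ae_restrict_iff' measurableSet_Ioi).2 (Filter.Eventually.of_forall ?_)
            intro t ht
            have : 0 < t := hT0.trans ht
            simp only [Pi.zero_apply]; positivity
      _ = _ := by
          rw [integral_const_mul, integral_Ioi_rpow_of_lt (by norm_num) hT0]
          congr 1
          norm_num
          rw [Real.rpow_neg_one]; rfl
  refine (add_le_add h1 h2).trans ?_
  rw [← ENNReal.ofReal_add (by positivity) (by positivity)]
  apply ENNReal.ofReal_le_ofReal
  rw [← Real.sqrt_eq_rpow]
  apply Real.le_sqrt_of_sq_le
  have hN' : N = m * T ^ 2 := by rw [hT2]; field_simp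
  have : m * T + N / T = 2 * m * T := by rw [hN']; field_simp; ring
  rw [this, hN']
  apply le_of_eq; ring

lemma aux_holder {α : Type*} [MeasurableSpace α] (μ : Measure α) [IsFiniteMeasure μ] (v : α → ℝ)
    (hv : Measurable v) (hv0 : ∀ x, 0 ≤ v x) (hvp : ∀ᵐ x ∂μ, 0 < v x)
    (N m a : ℝ) (hN : 0 < N) (hm : 0 < m) (ha : 0 < a)
    (hμ : μ univ = ENNReal.ofReal m)
    (h : ∀ s : ℝ, 0 < s → μ {x | s < v x} ≤ ENNReal.ofReal (N * s ^ (-2 : ℝ))) :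
    ENNReal.ofReal (m ^ (1 + a)) ≤
      ENNReal.ofReal ((4 * N) ^ a) * ∫⁻ x, ENNReal.ofReal (v x ^ (-(2 * a))) ∂μ := by
  have hK := aux_kolm μ v hv hv0 N m hN hm hμ h
  set r : ℝ := 1 + 2 * a with hr
  set r' : ℝ := r / (2 * a) with hr'
  have hr0 : 0 < r := by positivity
  have hr'0 : 0 < r' := by positivity
  have hc : r.HolderConjugate r' := by
    rw [Real.holderConjugate_iff]
    refine ⟨by linarith, ?_⟩
    rw [hr', hr]; field_simp
  have hH := ENNReal.lintegral_mul_le_Lp_mul_Lq μ hc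
    (f := fun x => ENNReal.ofReal (v x ^ (-(2 * a / r))))
    (g := fun x => ENNReal.ofReal (v x ^ (2 * a / r)))
    (by fun_prop) (by fun_prop)
  have e1 : ∫⁻ x, ((fun x => ENNReal.ofReal (v x ^ (-(2 * a / r)))) *
      (fun x => ENNReal.ofReal (v x ^ (2 * a / r)))) x ∂μ = ENNReal.ofReal m := by
    rw [← hμ, ← lintegral_one]
    apply lintegral_congr_ae
    filter_upwards [hvp] with x hx
    simp only [Pi.mul_apply]
    rw [← ENNReal.ofReal_mul (by positivity), ← Real.rpow_add hx]
    simp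
  have e2 : ∫⁻ x, ENNReal.ofReal (v x ^ (-(2 * a / r))) ^ r ∂μ
      = ∫⁻ x, ENNReal.ofReal (v x ^ (-(2 * a))) ∂μ := by
    apply lintegral_congr_ae
    filter_upwards [hvp] with x hx
    rw [ENNReal.ofReal_rpow_of_nonneg (by positivity) hr0.le, ← Real.rpow_mul hx.le]
    congr 2; field_simp
  have e3 : ∫⁻ x, ENNReal.ofReal (v x ^ (2 * a / r)) ^ r' ∂μ
      = ∫⁻ x, ENNReal.ofReal (v x) ∂μ := by
    apply lintegral_congr_ae
    filter_upwards [hvp] with x hx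
    rw [ENNReal.ofReal_rpow_of_nonneg (by positivity) hr'0.le, ← Real.rpow_mul hx.le]
    have : 2 * a / r * r' = 1 := by rw [hr']; field_simp
    rw [this, Real.rpow_one]
  rw [e1, e2, e3] at hH
  set S := ∫⁻ x, ENNReal.ofReal (v x ^ (-(2 * a))) ∂μ
  have h3 := ENNReal.rpow_le_rpow (hH.trans (mul_le_mul_right
    (ENNReal.rpow_le_rpow hK (by positivity : 0 ≤ 1 / r')) _)) hr0.le
  rw [ENNReal.mul_rpow_of_nonneg _ _ hr0.le, ← ENNReal.rpow_mul, ← ENNReal.rpow_mul,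
    one_div_mul_cancel hr0.ne', ENNReal.rpow_one,
    ENNReal.ofReal_rpow_of_pos hm, ENNReal.ofReal_rpow_of_pos (by positivity),
    ← Real.rpow_mul (by positivity)] at h3
  have : (1 / 2 : ℝ) * (1 / r' * r) = a := by rw [hr']; field_simp
  rw [this] at h3
  have e4 : m ^ (1 + a) = m ^ r * m ^ (-a) := by
    rw [← Real.rpow_add hm]; congr 1; rw [hr]; ring
  have e5 : (4 * N) ^ a = (4 * N * m) ^ a * m ^ (-a) := by
    rw [Real.mul_rpow (by positivity) hm.le, mul_assoc, ← Real.rpow_add hm]; simp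
  rw [e4, e5, ENNReal.ofReal_mul (by positivity), ENNReal.ofReal_mul (by positivity)]
  calc _ ≤ (S * ENNReal.ofReal ((4 * N * m) ^ a)) * ENNReal.ofReal (m ^ (-a)) := by gcongr
    _ = _ := by ring

lemma aux_real (p q e V N sE sQ A : ℝ) (hp : 1 < p) (hpq : p ≤ q) (he : 0 < e) (heV : e ≤ V)
    (hN : 0 < N) (hsE : 0 ≤ sE) (hsQ : 0 < sQ)
    (h1 : e ^ (1 + p / (p - 1) / q) ≤ (4 * N) ^ (p / (p - 1) / q) * sE)
    (h2 : (V⁻¹ * N) ^ (1 / q) * (V⁻¹ * sQ) ^ (1 - 1 / p) ≤ A) :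
    (e / V) ^ (2 * (p / (p - 1))) ≤ 4 ^ (p / (p - 1) / q) * A ^ (p / (p - 1)) * (sE / sQ) := by
  have hV : 0 < V := he.trans_le heV
  have hp1 : 0 < p - 1 := by linarith
  have hq : 0 < q := by linarith
  set p' := p / (p - 1) with hp'
  have hp'0 : 0 < p' := by positivity
  set a := p' / q with ha
  have h3 := Real.rpow_le_rpow (by positivity) h2 hp'0.le
  rw [Real.mul_rpow (by positivity) (by positivity), ← Real.rpow_mul (by positivity),
    ← Real.rpow_mul (by positivity)] at h3
  have i1 : 1 / q * p' = a := by rw [ha]; ring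
  have i2 : (1 - 1 / p) * p' = 1 := by rw [hp']; field_simp
  rw [i1, i2, Real.rpow_one] at h3
  have i3 : 1 + a ≤ 2 * p' := by
    have : a ≤ p' := by rw [ha]; exact div_le_self hp'0.le (by linarith)
    have : 1 ≤ p' := by rw [hp', le_div_iff₀ hp1]; linarith
    linarith
  have h4 : (e / V) ^ (2 * p') ≤ (e / V) ^ (1 + a) :=
    Real.rpow_le_rpow_of_exponent_ge (by positivity) ((div_le_one hV).2 heV) i3
  refine h4.trans ?_
  rw [Real.div_rpow he.le hV.le, Real.rpow_add hV, Real.rpow_one, ← mul_div_assoc, le_div_iff₀ hsQ]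
  rw [Real.mul_rpow (by positivity) (by positivity), Real.inv_rpow hV.le] at h3
  rw [Real.mul_rpow (by norm_num) hN.le] at h1
  calc _ ≤ 4 ^ a * N ^ a * sE / (V * V ^ a) * sQ := by gcongr
    _ = 4 ^ a * ((V ^ a)⁻¹ * N ^ a * (V⁻¹ * sQ)) * sE := by field_simp
    _ ≤ _ := by gcongr

/-- If `1 < p ≤ q < ∞`, `w ∈ A_{p,q}^*` and `σ = w^{-p'}`, then for every
cube `Q` and every measurable `E ⊆ Q` with `σ(E), σ(Q) > 0`,
`(|E|/|Q|)^{2p'} ≤ 4^{p'/q}·[w]_{A_{p,q}^*}^{p'}·(σ(E)/σ(Q))`. -/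
theorem statement10 (n : ℕ) (hn : 1 ≤ n) (p q : ℝ) (hp : 1 < p) (hpq : p ≤ q)
    (w : (Fin n → ℝ) → ℝ) (hwm : Measurable w) (hw0 : ∀ x, 0 ≤ w x)
    (hwpos : ∀ᵐ x ∂(volume : Measure (Fin n → ℝ)), 0 < w x)
    (hw : ApqStarConst n p q w < ∞) :
    ∀ Q : Set (Fin n → ℝ), IsCube n Q →
      ∀ E : Set (Fin n → ℝ), MeasurableSet E → E ⊆ Q →
        0 < (∫⁻ x in E, ENNReal.ofReal (w x ^ (-(p / (p - 1))))) →
        0 < (∫⁻ x in Q, ENNReal.ofReal (w x ^ (-(p / (p - 1))))) →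
        (volume E / volume Q) ^ (2 * (p / (p - 1))) ≤
          ENNReal.ofReal ((4 : ℝ) ^ ((p / (p - 1)) / q)) *
            ApqStarConst n p q w ^ (p / (p - 1)) *
            ((∫⁻ x in E, ENNReal.ofReal (w x ^ (-(p / (p - 1))))) /
              (∫⁻ x in Q, ENNReal.ofReal (w x ^ (-(p / (p - 1)))))) := by
  intro Q hQ E hE hEQ hsE hsQ
  have hp1 : 0 < p - 1 := by linarith
  have hq : 0 < q := by linarith
  have hA : ((volume Q)⁻¹ * wnormE n 1 (Q.indicator fun x => ENNReal.ofReal (w x ^ q))) ^ (1 / q) *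
      ((volume Q)⁻¹ * ∫⁻ x in Q, ENNReal.ofReal (w x ^ (-(p / (p - 1))))) ^ (1 - 1 / p)
      ≤ ApqStarConst n p q w := by
    unfold ApqStarConst
    exact le_iSup₂_of_le Q hQ le_rfl
  have hp'' : 0 < 1 - 1 / p := by
    rw [sub_pos, div_lt_one (by linarith)]; exact hp
  have hVtop : volume Q ≠ ∞ := by
    obtain ⟨a, h, hh, rfl⟩ := hQ
    exact (isCompact_univ_pi fun i => isCompact_Icc).measure_lt_top.ne
  have hE0 : volume E ≠ 0 := by
    intro h0
    rw [setLIntegral_measure_zero _ _ h0] at hsE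
    exact lt_irrefl _ hsE
  have hEV : volume E ≤ volume Q := measure_mono hEQ
  have hEtop : volume E ≠ ∞ := ne_top_of_le_ne_top hVtop hEV
  have hV0 : volume Q ≠ 0 := fun h => hE0 (le_antisymm (h ▸ hEV) zero_le)
  set N := wnormE n 1 (Q.indicator fun x => ENNReal.ofReal (w x ^ q)) with hNdef
  set sE := ∫⁻ x in E, ENNReal.ofReal (w x ^ (-(p / (p - 1)))) with hsEdef
  set sQ := ∫⁻ x in Q, ENNReal.ofReal (w x ^ (-(p / (p - 1)))) with hsQdef
  set A := ApqStarConst n p q w with hAdef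
  have hsEQ : sE ≤ sQ := lintegral_mono_set hEQ
  have hweak : ∀ t : ℝ, 0 < t →
      ENNReal.ofReal t * volume {x | x ∈ E ∧ t < w x ^ q} ≤ N := by
    intro t ht
    rw [hNdef]
    unfold wnormE
    refine le_iSup₂_of_le t ht ?_
    rw [div_one, ENNReal.rpow_one]
    gcongr
    rintro ⟨hx, hxt⟩
    rw [indicator_of_mem (hEQ hx)]
    exact (ENNReal.ofReal_lt_ofReal_iff (ht.trans hxt)).2 hxt
  have hN0 : N ≠ 0 := by
    intro h0
    apply hE0
    have hnull : volume (⋃ k : ℕ, {x | x ∈ E ∧ 1 / ((k : ℝ) + 1) < w x ^ q}) = 0 := by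
      refine measure_iUnion_null fun k => ?_
      have := hweak (1 / ((k : ℝ) + 1)) (by positivity)
      rw [h0] at this
      rcases mul_eq_zero.1 (le_antisymm this zero_le) with h | h
      · rw [ENNReal.ofReal_eq_zero] at h
        have : 0 < 1 / ((k : ℝ) + 1) := by positivity
        linarith
      · exact h
    rw [← nonpos_iff_eq_zero, ← hnull]
    refine measure_mono_ae ?_
    filter_upwards [hwpos] with x hx hxE
    obtain ⟨k, hk⟩ := exists_nat_one_div_lt (Real.rpow_pos_of_pos hx q)
    exact mem_iUnion.2 ⟨k, hxE, hk⟩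
  have hf1 : ((volume Q)⁻¹ * N) ^ (1 / q) ≠ 0 := by
    rw [Ne, ENNReal.rpow_eq_zero_iff_of_pos (by positivity)]
    exact mul_ne_zero (ENNReal.inv_ne_zero.2 hVtop) hN0
  have hf2 : ((volume Q)⁻¹ * sQ) ^ (1 - 1 / p) ≠ 0 := by
    rw [Ne, ENNReal.rpow_eq_zero_iff_of_pos hp'']
    exact mul_ne_zero (ENNReal.inv_ne_zero.2 hVtop) hsQ.ne'
  have hNtop : N ≠ ∞ := by
    intro h
    rw [h, ENNReal.mul_top (ENNReal.inv_ne_zero.2 hVtop), ENNReal.top_rpow_of_pos (by positivity),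
      ENNReal.top_mul hf2] at hA
    exact (hA.trans_lt hw).ne rfl
  have hsQtop : sQ ≠ ∞ := by
    intro h
    rw [h, ENNReal.mul_top (ENNReal.inv_ne_zero.2 hVtop), ENNReal.top_rpow_of_pos hp'',
      ENNReal.mul_top hf1] at hA
    exact (hA.trans_lt hw).ne rfl
  have hsEtop : sE ≠ ∞ := ne_top_of_le_ne_top hsQtop hsEQ
  have hNr : 0 < N.toReal := ENNReal.toReal_pos hN0 hNtop
  have her : 0 < (volume E).toReal := ENNReal.toReal_pos hE0 hEtop
  have hVr : 0 < (volume Q).toReal := ENNReal.toReal_pos hV0 hVtop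
  have hsQr : 0 < sQ.toReal := ENNReal.toReal_pos hsQ.ne' hsQtop
  have hsEr : 0 < sE.toReal := ENNReal.toReal_pos hsE.ne' hsEtop
  have hp'0 : 0 < p / (p - 1) := by positivity
  have : IsFiniteMeasure (volume.restrict E) :=
    ⟨by rw [Measure.restrict_apply_univ]; exact hEtop.lt_top⟩
  have key := aux_holder (volume.restrict E) (fun x => w x ^ (q / 2)) (by fun_prop)
    (fun x => Real.rpow_nonneg (hw0 x) _)
    (by filter_upwards [ae_restrict_of_ae hwpos] with x hx using Real.rpow_pos_of_pos hx _)
    N.toReal (volume E).toReal (p / (p - 1) / q) hNr her (by positivity)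
    (by rw [Measure.restrict_apply_univ, ENNReal.ofReal_toReal hEtop])
    (by
      intro s hs
      rw [Measure.restrict_apply (measurableSet_lt measurable_const (by fun_prop))]
      have h1 := hweak (s ^ 2) (by positivity)
      have hsub : {x | s < w x ^ (q / 2)} ∩ E ⊆ {x | x ∈ E ∧ s ^ 2 < w x ^ q} := by
        rintro x ⟨hx, hxE⟩
        refine ⟨hxE, ?_⟩
        have : w x ^ q = (w x ^ (q / 2)) ^ 2 := by
          rw [← Real.rpow_natCast, ← Real.rpow_mul (hw0 x)]; congr 1; push_cast; ring
        rw [this]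
        exact pow_lt_pow_left₀ hx hs.le two_ne_zero
      refine (measure_mono hsub).trans ?_
      have e : N.toReal * s ^ (-2 : ℝ) = N.toReal / s ^ 2 := by
        rw [Real.rpow_neg hs.le, div_eq_mul_inv]; norm_num
      rw [e, ENNReal.ofReal_div_of_pos (by positivity), ENNReal.ofReal_toReal hNtop,
        ENNReal.le_div_iff_mul_le (Or.inl (by simpa using hs.ne')) (Or.inl ENNReal.ofReal_ne_top),
        mul_comm]
      exact h1)
  have e1 : ∫⁻ x in E, ENNReal.ofReal ((w x ^ (q / 2)) ^ (-(2 * (p / (p - 1) / q)))) = sE := by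
    rw [hsEdef]
    refine lintegral_congr fun x => ?_
    rw [← Real.rpow_mul (hw0 x)]
    congr 2; field_simp
  simp only [e1] at key
  rw [← ENNReal.ofReal_toReal hsEtop, ← ENNReal.ofReal_mul (by positivity),
    ENNReal.ofReal_le_ofReal_iff (by positivity)] at key
  have hA' := ENNReal.toReal_mono hw.ne hA
  rw [ENNReal.toReal_mul, ← ENNReal.toReal_rpow, ← ENNReal.toReal_rpow, ENNReal.toReal_mul,
    ENNReal.toReal_mul, ENNReal.toReal_inv] at hA'
  have fin := aux_real p q _ _ _ _ _ _ hp hpq her (ENNReal.toReal_mono hVtop hEV) hNr hsEr.le hsQr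
    key hA'
  rw [← ENNReal.ofReal_toReal hsEtop, ← ENNReal.ofReal_toReal hsQtop,
    ← ENNReal.ofReal_toReal hw.ne, ← ENNReal.ofReal_toReal hEtop, ← ENNReal.ofReal_toReal hVtop,
    ← ENNReal.ofReal_div_of_pos hVr, ← ENNReal.ofReal_div_of_pos hsQr,
    ENNReal.ofReal_rpow_of_nonneg (by positivity) (by positivity),
    ENNReal.ofReal_rpow_of_nonneg (by positivity) (by positivity),
    ← ENNReal.ofReal_mul (by positivity), ← ENNReal.ofReal_mul (by positivity)]
  exact ENNReal.ofReal_le_ofReal fin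
end
end

section
/- Let n ≥ 1, 1 < p ≤ q < ∞, s > 1, and let w be a weight on ℝⁿ with w ∈ A_{p,q}^*, and set σ := w^{−p'}. Then for every cube Q and every measurable subset E ⊆ Q with σ(E) > 0 and σ(Q) > 0, one has (|E|/|Q|)^{s p'} ≤ [w]_{A_{p,q}^*}^{p'}·(s')^{s p'/q}·(σ(E)/σ(Q)), where s' = s/(s−1) and σ(A) := ∫_A σ dx. -/
open MeasureTheory Set
open scoped ENNReal

noncomputable section

lemma kolm_s11 {α : Type*} [MeasurableSpace α] (μ : Measure α) [IsProbabilityMeasure μ]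
    (g : α → ℝ) (hg : Measurable g) (hg0 : ∀ x, 0 ≤ g x) (N : ℝ) (hN : 0 < N)
    (h : ∀ t : ℝ, 0 < t → ENNReal.ofReal t * μ {x | t < g x} ≤ ENNReal.ofReal N)
    (δ : ℝ) (hδ : 0 < δ) (hδ1 : δ < 1) :
    ∫⁻ x, ENNReal.ofReal (g x ^ δ) ∂μ ≤ ENNReal.ofReal (N ^ δ / (1 - δ)) := by
  rw [lintegral_rpow_eq_lintegral_meas_lt_mul μ (ae_of_all _ hg0) hg.aemeasurable hδ]
  rw [← Ioc_union_Ioi_eq_Ioi hN.le, lintegral_union measurableSet_Ioi (by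
    rw [Set.disjoint_left]; intro x hx hx'; exact not_lt.2 hx.2 hx')]
  have h1 : ∫⁻ t in Ioc 0 N, μ {x | t < g x} * ENNReal.ofReal (t ^ (δ - 1)) ≤
      ENNReal.ofReal (N ^ δ / δ) := by
    calc _ ≤ ∫⁻ t in Ioc 0 N, ENNReal.ofReal (t ^ (δ - 1)) := by
          apply lintegral_mono
          intro t
          simpa using mul_le_mul_left (prob_le_one (μ := μ) (s := {x | t < g x})) (ENNReal.ofReal (t ^ (δ - 1)))
      _ = ENNReal.ofReal (∫ t in Ioc 0 N, t ^ (δ - 1)) := by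
          rw [ofReal_integral_eq_lintegral_ofReal]
          · exact (intervalIntegrable_iff_integrableOn_Ioc_of_le hN.le).1
              (intervalIntegral.intervalIntegrable_rpow' (by linarith))
          · filter_upwards [ae_restrict_mem measurableSet_Ioc] with t ht
            exact Real.rpow_nonneg ht.1.le _
      _ = _ := by
          rw [← intervalIntegral.integral_of_le hN.le, integral_rpow (Or.inl (by linarith))]
          simp [Real.zero_rpow hδ.ne']
  have h2 : ∫⁻ t in Ioi N, μ {x | t < g x} * ENNReal.ofReal (t ^ (δ - 1)) ≤
      ENNReal.ofReal (N ^ δ / (1 - δ)) := by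
    calc _ ≤ ∫⁻ t in Ioi N, ENNReal.ofReal (N * t ^ (δ - 2)) := by
          apply setLIntegral_mono' measurableSet_Ioi
          intro t ht
          have ht0 : 0 < t := hN.trans ht
          have e : t ^ (δ - 1) = t * t ^ (δ - 2) := by
            rw [← Real.rpow_one_add' ht0.le (by linarith)]; congr 1; ring
          rw [e, ENNReal.ofReal_mul ht0.le, ENNReal.ofReal_mul hN.le, ← mul_assoc, mul_comm (μ _)]
          exact mul_le_mul_left (h t ht0) _
      _ = ENNReal.ofReal (∫ t in Ioi N, N * t ^ (δ - 2)) := by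
          rw [ofReal_integral_eq_lintegral_ofReal]
          · exact (integrableOn_Ioi_rpow_of_lt (by linarith) hN).const_mul _
          · filter_upwards [ae_restrict_mem measurableSet_Ioi] with t ht
            exact mul_nonneg hN.le (Real.rpow_nonneg (hN.trans ht).le _)
      _ = _ := by
          rw [integral_const_mul, integral_Ioi_rpow_of_lt (by linarith) hN]
          congr 1
          have : N ^ δ = N * N ^ (δ - 2 + 1) := by
            rw [← Real.rpow_one_add' hN.le (by linarith)]; congr 1; ring
          rw [this]
          have : δ - 2 + 1 ≠ 0 := by linarith
          have : 1 - δ ≠ 0 := by linarith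
          field_simp
          ring
  calc _ ≤ ENNReal.ofReal δ * (ENNReal.ofReal (N ^ δ / δ) + ENNReal.ofReal (N ^ δ / (1 - δ))) := by
        gcongr
    _ = _ := by
        have := Real.rpow_pos_of_pos hN δ
        have : 0 < 1 - δ := by linarith
        rw [← ENNReal.ofReal_add (by positivity) (by positivity), ← ENNReal.ofReal_mul hδ.le]
        congr 1
        field_simp
        ring

lemma hol {α : Type*} [MeasurableSpace α] (μ : Measure α) [IsProbabilityMeasure μ]
    (w : α → ℝ) (hw : Measurable w) (hpos : ∀ᵐ x ∂μ, 0 < w x) (E : Set α) (hE : MeasurableSet E)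
    (q q' s r : ℝ) (hq : q.HolderConjugate q') (hs : 0 < s) (hr : 0 < r) (hqr : q' ≤ s * r) :
    μ E ≤ (∫⁻ x, ENNReal.ofReal ((w x ^ q) ^ (1 / s)) ∂μ) ^ (1 / q) *
      (∫⁻ x in E, ENNReal.ofReal (w x ^ (-r)) ∂μ) ^ (1 / (s * r)) := by
  set f : α → ℝ≥0∞ := fun x => ENNReal.ofReal (w x ^ (1 / s))
  set g : α → ℝ≥0∞ := E.indicator fun x => ENNReal.ofReal (w x ^ (-(1 / s)))
  have hf : Measurable f := by fun_prop
  have hg : Measurable g := Measurable.indicator (by fun_prop) hE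
  calc μ E = ∫⁻ x, (f * g) x ∂μ := by
        rw [← lintegral_indicator_one hE]
        apply lintegral_congr_ae
        filter_upwards [hpos] with x hx
        by_cases hxE : x ∈ E
        · simp only [f, g, hxE, Pi.mul_apply, indicator_of_mem, Pi.one_apply]
          rw [← ENNReal.ofReal_mul (by positivity), ← Real.rpow_add hx]; simp
        · simp [g, hxE]
    _ ≤ (∫⁻ x, f x ^ q ∂μ) ^ (1 / q) * (∫⁻ x, g x ^ q' ∂μ) ^ (1 / q') :=
        ENNReal.lintegral_mul_le_Lp_mul_Lq μ hq hf.aemeasurable hg.aemeasurable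
    _ ≤ (∫⁻ x, f x ^ q ∂μ) ^ (1 / q) * (∫⁻ x, g x ^ (s * r) ∂μ) ^ (1 / (s * r)) := by
        gcongr
        have := eLpNorm'_le_eLpNorm'_of_exponent_le hq.symm.pos hqr μ hg.aestronglyMeasurable
        simpa [eLpNorm'] using this
    _ = _ := by
        congr 2
        · apply lintegral_congr_ae
          filter_upwards [hpos] with x hx
          simp only [f]
          rw [ENNReal.ofReal_rpow_of_pos (by positivity), ← Real.rpow_mul hx.le, ← Real.rpow_mul hx.le, mul_comm]
        · rw [← lintegral_indicator hE]
          apply lintegral_congr_ae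
          filter_upwards [hpos] with x hx
          by_cases hxE : x ∈ E
          · simp only [g, hxE, indicator_of_mem]
            rw [ENNReal.ofReal_rpow_of_pos (by positivity), ← Real.rpow_mul hx.le]
            congr 2; field_simp
          · simp only [g, hxE, not_false_eq_true, indicator_of_notMem]
            exact ENNReal.zero_rpow_of_pos (by positivity)

/-- If `1 < p ≤ q < ∞`, `s > 1`, `w ∈ A_{p,q}^*` and `σ = w^{-p'}`, then for
every cube `Q` and every measurable `E ⊆ Q` with `σ(E), σ(Q) > 0`,
`(|E|/|Q|)^{sp'} ≤ [w]_{A_{p,q}^*}^{p'}·(s')^{sp'/q}·(σ(E)/σ(Q))` with `s' = s/(s-1)`. -/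
theorem statement11 (n : ℕ) (hn : 1 ≤ n) (p q : ℝ) (hp : 1 < p) (hpq : p ≤ q)
    (s : ℝ) (hs : 1 < s)
    (w : (Fin n → ℝ) → ℝ) (hwm : Measurable w) (hw0 : ∀ x, 0 ≤ w x)
    (hwpos : ∀ᵐ x ∂(volume : Measure (Fin n → ℝ)), 0 < w x)
    (hw : ApqStarConst n p q w < ∞) :
    ∀ Q : Set (Fin n → ℝ), IsCube n Q →
      ∀ E : Set (Fin n → ℝ), MeasurableSet E → E ⊆ Q →
        0 < (∫⁻ x in E, ENNReal.ofReal (w x ^ (-(p / (p - 1))))) →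
        0 < (∫⁻ x in Q, ENNReal.ofReal (w x ^ (-(p / (p - 1))))) →
        (volume E / volume Q) ^ (s * (p / (p - 1))) ≤
          ApqStarConst n p q w ^ (p / (p - 1)) *
            ENNReal.ofReal ((s / (s - 1)) ^ (s * (p / (p - 1)) / q)) *
            ((∫⁻ x in E, ENNReal.ofReal (w x ^ (-(p / (p - 1))))) /
              (∫⁻ x in Q, ENNReal.ofReal (w x ^ (-(p / (p - 1)))))) := by
  intro Q hQ E hE hEQ hσE hσQ
  set r : ℝ := p / (p - 1) with hr
  have hp1 : 0 < p - 1 := by linarith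
  have hq1 : 1 < q := by linarith
  have hr0 : 0 < r := by positivity
  have hs0 : 0 < s := by linarith
  have hq0 : 0 < q := by linarith
  have hs1 : 0 < s - 1 := by linarith
  have hrp : (1 - 1 / p) * r = 1 := by rw [hr]; field_simp
  have hrp0 : 0 < 1 - 1 / p := by
    have : 1 / p < 1 := by rw [div_lt_one (by linarith)]; exact hp
    linarith
  set C := ApqStarConst n p q w with hC
  have hQm : MeasurableSet Q := by
    obtain ⟨a, h, hh, rfl⟩ := hQ
    exact MeasurableSet.univ_pi fun i => measurableSet_Icc
  have hQv : volume Q = ENNReal.ofReal ((hQ.choose_spec.choose) ^ n) := by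
    obtain ⟨hh, e⟩ := hQ.choose_spec.choose_spec
    conv_lhs => rw [e]
    rw [volume_pi_pi]
    rw [ENNReal.ofReal_pow hh.le]
    simp
  have hQ0 : volume Q ≠ 0 := by
    rw [hQv]
    have := pow_pos hQ.choose_spec.choose_spec.1 n
    simpa using this
  have hQt : volume Q ≠ ∞ := by rw [hQv]; exact ENNReal.ofReal_ne_top
  set V := volume Q with hV
  set N0 := wnormE n 1 (Q.indicator fun x => ENNReal.ofReal (w x ^ q)) with hN0
  set M := V⁻¹ * N0 with hM
  set σE := ∫⁻ x in E, ENNReal.ofReal (w x ^ (-r)) with hσEd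
  set σQ := ∫⁻ x in Q, ENNReal.ofReal (w x ^ (-r)) with hσQd
  set S := V⁻¹ * σQ with hS
  have hMS : M ^ (1 / q) * S ^ (1 - 1 / p) ≤ C :=
    le_iSup₂ (f := fun (Q : Set (Fin n → ℝ)) (_ : IsCube n Q) =>
      ((volume Q)⁻¹ * wnormE n 1 (Q.indicator fun x => ENNReal.ofReal (w x ^ q))) ^ (1 / q) *
      ((volume Q)⁻¹ * ∫⁻ x in Q, ENNReal.ofReal (w x ^ (-(p / (p - 1))))) ^ (1 - 1 / p)) Q hQ
  have hMSt : M ^ (1 / q) * S ^ (1 - 1 / p) ≠ ∞ := (hMS.trans_lt hw).ne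
  have hset : ∀ t : ℝ, 0 < t →
      {x | ENNReal.ofReal t < Q.indicator (fun x => ENNReal.ofReal (w x ^ q)) x} =
        {x | t < w x ^ q} ∩ Q := by
    intro t ht
    ext x
    by_cases hx : x ∈ Q
    · simp [hx, ENNReal.ofReal_lt_ofReal_iff_of_nonneg ht.le]
    · simp [hx]
  have hweak : ∀ t : ℝ, 0 < t → ENNReal.ofReal t * volume ({x | t < w x ^ q} ∩ Q) ≤ N0 := by
    intro t ht
    have := le_iSup₂ (f := fun (t : ℝ) (_ : 0 < t) => ENNReal.ofReal t *
      volume {x | ENNReal.ofReal t < Q.indicator (fun x => ENNReal.ofReal (w x ^ q)) x}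
        ^ (1 / (1 : ℝ))) t ht
    simp only [hset t ht, div_one, ENNReal.rpow_one] at this
    simpa only [hN0, wnormE, div_one, ENNReal.rpow_one] using this
  have hVi0 : V⁻¹ ≠ 0 := by simpa using hQt
  have hVit : V⁻¹ ≠ ∞ := by simpa using hQ0
  have hN00 : N0 ≠ 0 := by
    intro h0
    have hz : ∀ k : ℕ, volume ({x | 1 / ((k : ℝ) + 1) < w x ^ q} ∩ Q) = 0 := by
      intro k
      have hk : (0 : ℝ) < 1 / ((k : ℝ) + 1) := by positivity
      have := hweak _ hk
      rw [h0] at this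
      have := le_antisymm this zero_le
      rcases mul_eq_zero.1 this with h | h
      · exact absurd (ENNReal.ofReal_eq_zero.1 h) (not_le.2 hk)
      · exact h
    have hz2 := measure_iUnion_null hz
    apply hQ0
    rw [hV]
    refine measure_mono_null (t := (⋃ k : ℕ, ({x | 1 / ((k : ℝ) + 1) < w x ^ q} ∩ Q)) ∪ {x | ¬ 0 < w x})
      ?_ (measure_union_null hz2 (ae_iff.1 hwpos))
    intro x hx
    by_cases hwx : 0 < w x
    · left
      obtain ⟨k, hk⟩ := exists_nat_one_div_lt (Real.rpow_pos_of_pos hwx q)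
      exact mem_iUnion.2 ⟨k, hk, hx⟩
    · right; exact hwx
  have hM0 : M ≠ 0 := mul_ne_zero hVi0 hN00
  have hS0 : S ≠ 0 := mul_ne_zero hVi0 hσQ.ne'
  have hMt : M ≠ ∞ := by
    intro h
    apply hMSt
    rw [h, ENNReal.top_rpow_of_pos (by positivity), ENNReal.top_mul]
    intro h0
    rcases (ENNReal.rpow_eq_zero_iff.1 h0) with h | h
    · exact hS0 h.1
    · linarith [h.2]
  have hSt : S ≠ ∞ := by
    intro h
    apply hMSt
    rw [h, ENNReal.top_rpow_of_pos hrp0, ENNReal.mul_top]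
    have : (0 : ℝ) ≤ q := hq0.le
    simp [ENNReal.rpow_eq_zero_iff, hM0, this]
  set N := M.toReal with hN
  have hNpos : 0 < N := ENNReal.toReal_pos hM0 hMt
  have hNM : ENNReal.ofReal N = M := ENNReal.ofReal_toReal hMt
  set μ : Measure (Fin n → ℝ) := V⁻¹ • volume.restrict Q with hμ
  have : IsProbabilityMeasure μ := ⟨by
    simp [hμ, ← hV, ENNReal.inv_mul_cancel hQ0 hQt]⟩
  have hae : ∀ᵐ x ∂μ, 0 < w x :=
    Measure.ae_smul_measure (ae_restrict_of_ae hwpos) _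
  have hK := kolm_s11 μ (fun x => w x ^ q) (by fun_prop) (fun x => Real.rpow_nonneg (hw0 x) q) N hNpos
    (by
      intro t ht
      rw [hNM, hμ, Measure.smul_apply, Measure.restrict_apply (measurableSet_lt measurable_const
        (by fun_prop)), smul_eq_mul, mul_left_comm]
      exact mul_le_mul_right (hweak t ht) _) (1 / s) (by positivity)
      (by rw [div_lt_one hs0]; exact hs)
  have hconj := Real.HolderConjugate.conjExponent hq1
  have hH := hol μ w hwm hae E hE q _ s r hconj hs0 hr0 (by
    rw [Real.conjExponent, hr]
    have h1 : q / (q - 1) ≤ p / (p - 1) := by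
      rw [div_le_div_iff₀ (by linarith) hp1]; nlinarith
    nlinarith)
  have hT : ∫⁻ x in E, ENNReal.ofReal (w x ^ (-r)) ∂μ = V⁻¹ * σE := by
    rw [hμ, Measure.restrict_smul, lintegral_smul_measure, Measure.restrict_restrict hE,
      inter_eq_left.2 hEQ, smul_eq_mul]
  have hA : μ E = volume E / V := by
    rw [hμ, Measure.smul_apply, Measure.restrict_apply hE, inter_eq_left.2 hEQ, smul_eq_mul,
      mul_comm, div_eq_mul_inv]
  rw [hT, hA] at hH
  have hsr : 0 < s * r := by positivity
  have e1 : ENNReal.ofReal (N ^ (1 / s) / (1 - 1 / s)) ^ (1 / q * (s * r)) =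
      M ^ (r / q) * ENNReal.ofReal ((s / (s - 1)) ^ (s * r / q)) := by
    have hd : N ^ (1 / s) / (1 - 1 / s) = N ^ (1 / s) * (s / (s - 1)) := by
      field_simp
    have hss : 0 < s / (s - 1) := by positivity
    have hNs := Real.rpow_pos_of_pos hNpos (1 / s)
    rw [hd, ENNReal.ofReal_mul hNs.le, ENNReal.mul_rpow_of_nonneg _ _ (by positivity),
      ← ENNReal.ofReal_rpow_of_pos hNpos, hNM, ← ENNReal.rpow_mul,
      ENNReal.ofReal_rpow_of_pos hss]
    congr 2
    · field_simp
    · congr 1; field_simp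
  calc (volume E / V) ^ (s * r)
      ≤ (ENNReal.ofReal (N ^ (1 / s) / (1 - 1 / s)) ^ (1 / q) * (V⁻¹ * σE) ^ (1 / (s * r)))
          ^ (s * r) := by
        refine ENNReal.rpow_le_rpow (hH.trans ?_) hsr.le
        gcongr
    _ = M ^ (r / q) * ENNReal.ofReal ((s / (s - 1)) ^ (s * r / q)) * (V⁻¹ * σE) := by
        rw [ENNReal.mul_rpow_of_nonneg _ _ hsr.le, ← ENNReal.rpow_mul, e1, ← ENNReal.rpow_mul,
          one_div_mul_cancel hsr.ne', ENNReal.rpow_one]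
    _ = (M ^ (r / q) * S) * ENNReal.ofReal ((s / (s - 1)) ^ (s * r / q)) * (σE / σQ) := by
        have hσt : σQ ≠ ∞ := by
          intro h
          apply hSt
          rw [hS, h, ENNReal.mul_top hVi0]
        have : V⁻¹ * σE = S * (σE / σQ) := by
          rw [hS, mul_assoc, ENNReal.mul_div_cancel hσQ.ne' hσt]
        rw [this]; ring
    _ ≤ _ := by
        gcongr
        calc M ^ (r / q) * S = (M ^ (1 / q) * S ^ (1 - 1 / p)) ^ r := by
              rw [ENNReal.mul_rpow_of_nonneg _ _ hr0.le, ← ENNReal.rpow_mul, ← ENNReal.rpow_mul,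
                hrp, ENNReal.rpow_one, one_div_mul_eq_div]
          _ ≤ C ^ r := ENNReal.rpow_le_rpow hMS hr0.le
end
end

section
/- Let 1 < p < ∞ and let w be a weight on ℝ. Then w ∈ A_p^* if and only if sup_Q ‖w(x)·|Q|^{p−1}/(|Q|^p + |x − x_Q|^p)‖_{L^{1,∞}}·(⨍_Q w^{1−p'} dx)^{p−1} < ∞, where the supremum is over all bounded intervals Q ⊂ ℝ, x_Q denotes the center of Q, |Q| its length, and the weak norm is taken over all of ℝ. -/
open MeasureTheory Set
open scoped ENNReal

noncomputable section

/-- The weak `L^p` quasinorm of an `ℝ≥0∞`-valued function on `ℝ`. -/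
def wnormER (p : ℝ) (g : ℝ → ℝ≥0∞) : ℝ≥0∞ :=
  ⨆ (t : ℝ) (_ : 0 < t), ENNReal.ofReal t * volume {x | ENNReal.ofReal t < g x} ^ (1 / p)

/-- The multiplier `A_p^*` characteristic on `ℝ`, the supremum running over all bounded
intervals `Q = [a, a+h]`, `h > 0`. -/
def ApStarConstR (p : ℝ) (w : ℝ → ℝ) : ℝ≥0∞ :=
  ⨆ (a : ℝ) (h : ℝ) (_ : 0 < h),
    (volume (Set.Icc a (a + h)))⁻¹ *
        wnormER 1 ((Set.Icc a (a + h)).indicator fun x => ENNReal.ofReal (w x)) *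
      ((volume (Set.Icc a (a + h)))⁻¹ *
          ∫⁻ x in Set.Icc a (a + h), ENNReal.ofReal (w x ^ (1 - p / (p - 1)))) ^ (p - 1)


lemma aux_wnorm_le {g : ℝ → ℝ≥0∞} {t : ℝ} (ht : 0 < t) :
    ENNReal.ofReal t * volume {x | ENNReal.ofReal t < g x} ≤ wnormER 1 g := by
  have := le_iSup₂ (f := fun (t : ℝ) (_ : 0 < t) =>
    ENNReal.ofReal t * volume {x | ENNReal.ofReal t < g x} ^ (1 / (1:ℝ))) t ht
  simpa [wnormER] using this

lemma aux_wnorm_bound {g : ℝ → ℝ≥0∞} {B : ℝ≥0∞}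
    (h : ∀ t : ℝ, 0 < t → ENNReal.ofReal t * volume {x | ENNReal.ofReal t < g x} ≤ B) :
    wnormER 1 g ≤ B := by
  unfold wnormER
  refine iSup₂_le fun t ht => ?_
  simpa using h t ht

lemma aux_level {w : ℝ → ℝ} (hw0 : ∀ x, 0 ≤ w x) {Q : Set ℝ} {t : ℝ} (ht : 0 < t) :
    {x | ENNReal.ofReal t < Q.indicator (fun x => ENNReal.ofReal (w x)) x}
      = {x | x ∈ Q ∧ t < w x} := by
  ext x
  by_cases hx : x ∈ Q
  · simp only [mem_setOf_eq, indicator_of_mem hx, hx, true_and]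
    exact ENNReal.ofReal_lt_ofReal_iff_of_nonneg ht.le
  · simp [hx]

lemma aux_vol {w : ℝ → ℝ} (hw0 : ∀ x, 0 ≤ w x) {Q : Set ℝ} {t : ℝ} (ht : 0 < t) :
    volume {x | x ∈ Q ∧ t < w x} ≤
      ENNReal.ofReal t⁻¹ * wnormER 1 (Q.indicator fun x => ENNReal.ofReal (w x)) := by
  have := aux_wnorm_le (g := Q.indicator fun x => ENNReal.ofReal (w x)) ht
  rw [aux_level hw0 ht] at this
  calc volume {x | x ∈ Q ∧ t < w x}
      = ENNReal.ofReal t⁻¹ * (ENNReal.ofReal t * volume {x | x ∈ Q ∧ t < w x}) := by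
        rw [← mul_assoc, ← ENNReal.ofReal_mul (by positivity), inv_mul_cancel₀ ht.ne']; simp
    _ ≤ _ := by gcongr

/-- doubling -/
lemma aux_doubling (p : ℝ) (hp : 1 < p) (w : ℝ → ℝ) (hwm : Measurable w) (hw0 : ∀ x, 0 ≤ w x)
    (hwpos : ∀ᵐ x ∂(volume : Measure ℝ), 0 < w x) (K : ℝ) (hK : 0 < K)
    (hyp : ∀ c H : ℝ, 0 < H →
      wnormER 1 ((Icc (c - H/2) (c + H/2)).indicator fun x => ENNReal.ofReal (w x)) *
        (∫⁻ x in Icc (c - H/2) (c + H/2), ENNReal.ofReal (w x ^ (1 - p / (p - 1)))) ^ (p - 1)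
        ≤ ENNReal.ofReal (K * H ^ p)) :
    ∃ g : ℝ, 0 < g ∧ g < 1 ∧ ∀ c H : ℝ, 0 < H →
      (∫⁻ x in Icc (c - H/2) (c + H/2), ENNReal.ofReal (w x ^ (1 - p / (p - 1)))) ≤
      ENNReal.ofReal g *
      (∫⁻ x in Icc (c - (2*H)/2) (c + (2*H)/2), ENNReal.ofReal (w x ^ (1 - p / (p - 1)))) := by
  have hp1 : 0 < p - 1 := by linarith
  set q : ℝ := 1 / (p - 1) with hq
  have hq0 : 0 < q := by positivity
  set δ : ℝ := (1/4) * (4 * K) ^ (-q) with hδ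
  have hδ0 : 0 < δ := by positivity
  have hexp : 1 - p / (p - 1) = -q := by rw [hq]; field_simp; ring
  simp only [hexp] at hyp ⊢
  refine ⟨(1+δ)⁻¹, by positivity, inv_lt_one_of_one_lt₀ (by linarith), fun c H' hH' => ?_⟩
  have hyp' := hyp c (2*H') (by linarith)
  set H := 2 * H' with hH
  have hH0 : 0 < H := by linarith
  set Q := Icc (c - H/2) (c + H/2) with hQ
  set Q0 := Icc (c - H'/2) (c + H'/2) with hQ0
  set σ : ℝ → ℝ≥0∞ := fun x => ENNReal.ofReal (w x ^ (-q)) with hσ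
  have hσm : Measurable σ := by
    exact ENNReal.measurable_ofReal.comp (hwm.pow_const _)
  have hsub : Q0 ⊆ Q := Icc_subset_Icc (by linarith) (by linarith)
  have hvolQ : volume Q = ENNReal.ofReal H := by
    rw [hQ, Real.volume_Icc]; congr 1; ring
  have hvolQ0 : volume Q0 = ENNReal.ofReal (H/2) := by
    rw [hQ0, Real.volume_Icc]; congr 1; rw [hH]; ring
  set S := ∫⁻ x in Q, σ x with hS
  set W := wnormER 1 (Q.indicator fun x => ENNReal.ofReal (w x)) with hW
  have hsplit : S = (∫⁻ x in Q0, σ x) + ∫⁻ x in Q \ Q0, σ x := by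
    rw [hS, ← lintegral_inter_add_diff (μ := volume) σ Q (measurableSet_Icc : MeasurableSet Q0),
      inter_eq_self_of_subset_right hsub]
  have key : ENNReal.ofReal δ * S ≤ ∫⁻ x in Q \ Q0, σ x := by
    by_cases hS0 : S = 0
    · simp [hS0]
    have hW0 : W ≠ 0 := by
      intro hW0
      have h1 : ∀ n : ℕ, volume {x | x ∈ Q ∧ 1 / ((n:ℝ)+1) < w x} = 0 := by
        intro n
        have := aux_vol hw0 (Q := Q) (t := 1 / ((n:ℝ)+1)) (by positivity)
        rw [← hW, hW0] at this
        simpa using this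
      have h2 : volume (⋃ n : ℕ, {x | x ∈ Q ∧ 1 / ((n:ℝ)+1) < w x}) = 0 :=
        measure_iUnion_null h1
      have h3 : volume {x | ¬ 0 < w x} = 0 := hwpos
      have h4 : Q ⊆ (⋃ n : ℕ, {x | x ∈ Q ∧ 1 / ((n:ℝ)+1) < w x}) ∪ {x | ¬ 0 < w x} := by
        intro x hx
        by_cases hwx : 0 < w x
        · left
          obtain ⟨n, hn⟩ := exists_nat_one_div_lt hwx
          exact mem_iUnion.2 ⟨n, hx, hn⟩
        · right; exact hwx
      have h5 : volume Q = 0 := measure_mono_null h4 (measure_union_null h2 h3)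
      rw [hvolQ] at h5
      simp at h5; linarith
    have hWtop : W ≠ ∞ := by
      intro h
      rw [h, ENNReal.top_mul] at hyp'
      · simp at hyp'
      · intro h0
        rw [ENNReal.rpow_eq_zero_iff] at h0
        rcases h0 with h0 | h0
        · exact hS0 h0.1
        · linarith [h0.2]
    have hStop : S ≠ ∞ := by
      intro h
      rw [h, ENNReal.top_rpow_of_pos hp1, ENNReal.mul_top hW0] at hyp'
      simp at hyp'
    set W' := W.toReal with hW'
    set S' := S.toReal with hS'
    have hWe : W = ENNReal.ofReal W' := (ENNReal.ofReal_toReal hWtop).symm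
    have hSe : S = ENNReal.ofReal S' := (ENNReal.ofReal_toReal hStop).symm
    have hWp : 0 < W' := ENNReal.toReal_pos hW0 hWtop
    have hSp : 0 < S' := ENNReal.toReal_pos hS0 hStop
    have hreal : W' * S' ^ (p-1) ≤ K * H ^ p := by
      rw [hWe, hSe, ENNReal.ofReal_rpow_of_pos hSp, ← ENNReal.ofReal_mul hWp.le] at hyp'
      exact (ENNReal.ofReal_le_ofReal_iff (by positivity)).1 hyp'
    set t := 4 * W' / H with ht
    have ht0 : 0 < t := by positivity
    have hv1 : volume {x | x ∈ Q ∧ t < w x} ≤ ENNReal.ofReal (H/4) := by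
      refine (aux_vol hw0 ht0).trans ?_
      rw [← hW, hWe, ← ENNReal.ofReal_mul (by positivity)]
      apply ENNReal.ofReal_le_ofReal
      rw [ht]; apply le_of_eq; field_simp
    set G := {x | x ∈ Q \ Q0 ∧ w x ≤ t} with hG
    have hGm : MeasurableSet G :=
      (measurableSet_Icc.diff measurableSet_Icc).inter (measurableSet_le hwm measurable_const)
    have hv2 : ENNReal.ofReal (H/4) ≤ volume G := by
      have h1 : Q ⊆ (Q0 ∪ {x | x ∈ Q ∧ t < w x}) ∪ G := by
        intro x hx
        by_cases h1 : x ∈ Q0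
        · exact Or.inl (Or.inl h1)
        · by_cases h2 : t < w x
          · exact Or.inl (Or.inr ⟨hx, h2⟩)
          · exact Or.inr ⟨⟨hx, h1⟩, not_lt.1 h2⟩
      have h2 : ENNReal.ofReal H ≤ ENNReal.ofReal (H/2) + ENNReal.ofReal (H/4) + volume G := by
        rw [← hvolQ]
        refine (measure_mono h1).trans ((measure_union_le _ _).trans ?_)
        gcongr
        refine (measure_union_le _ _).trans ?_
        rw [hvolQ0]
        gcongr
      rw [← ENNReal.ofReal_add (by positivity) (by positivity)] at h2
      have h3 : ENNReal.ofReal H = ENNReal.ofReal (H/2 + H/4) + ENNReal.ofReal (H/4) := by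
        rw [← ENNReal.ofReal_add (by positivity) (by positivity)]; congr 1; ring
      rw [h3] at h2
      exact (ENNReal.add_le_add_iff_left ENNReal.ofReal_ne_top).1 h2
    have hlow : ENNReal.ofReal (t ^ (-q)) * volume G ≤ ∫⁻ x in Q \ Q0, σ x := by
      calc ENNReal.ofReal (t ^ (-q)) * volume G
          = ∫⁻ x in G, ENNReal.ofReal (t ^ (-q)) := by simp
        _ ≤ ∫⁻ x in G, σ x := by
            apply setLIntegral_mono_ae hσm.aemeasurable
            filter_upwards [hwpos] with x hx hxG
            apply ENNReal.ofReal_le_ofReal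
            exact Real.rpow_le_rpow_of_nonpos hx hxG.2 (by linarith)
        _ ≤ _ := lintegral_mono_set (fun x hx => hx.1)
    refine le_trans ?_ hlow
    refine le_trans ?_ (mul_le_mul_right hv2 _)
    rw [hSe, ← ENNReal.ofReal_mul hδ0.le, ← ENNReal.ofReal_mul (by positivity)]
    apply ENNReal.ofReal_le_ofReal
    have h1 : S' ^ (p-1) ≤ K * H ^ p / W' := by
      rw [le_div_iff₀ hWp]; linarith
    have h2 : S' ≤ (K * H ^ p / W') ^ q := by
      have := Real.rpow_le_rpow (by positivity) h1 hq0.le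
      rw [← Real.rpow_mul hSp.le, hq, mul_one_div_cancel hp1.ne', Real.rpow_one] at this
      exact this
    have h3 : (K * H ^ p / W') ^ q = K ^ q * W' ^ (-q) * H ^ (1 + q) := by
      rw [Real.div_rpow (by positivity) hWp.le, Real.mul_rpow hK.le (by positivity),
        ← Real.rpow_mul hH0.le, Real.rpow_neg hWp.le]
      have : p * q = 1 + q := by rw [hq]; field_simp; ring
      rw [this]; ring
    have h4 : δ * (K ^ q * W' ^ (-q) * H ^ (1 + q)) = t ^ (-q) * (H / 4) := by
      rw [hδ, ht, Real.div_rpow (by positivity) hH0.le, Real.mul_rpow (by norm_num) hK.le,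
        Real.mul_rpow (by norm_num) hWp.le, Real.rpow_add hH0, Real.rpow_one,
        Real.rpow_neg hK.le, Real.rpow_neg hH0.le]
      have := (Real.rpow_pos_of_pos hK q).ne'
      have := (Real.rpow_pos_of_pos hH0 q).ne'
      field_simp
    rw [← h4, ← h3]
    gcongr
  have h1 : ENNReal.ofReal (1+δ) * (∫⁻ x in Q0, σ x) ≤ S := by
    rw [ENNReal.ofReal_add zero_le_one hδ0.le, add_mul]
    calc _ ≤ (∫⁻ x in Q0, σ x) + ENNReal.ofReal δ * S := by
          gcongr
          · simp
          · exact lintegral_mono_set hsub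
      _ ≤ _ := by rw [hsplit] at key ⊢; gcongr
  calc (∫⁻ x in Q0, σ x) = ENNReal.ofReal (1+δ)⁻¹ * (ENNReal.ofReal (1+δ) * (∫⁻ x in Q0, σ x)) := by
        rw [← mul_assoc, ← ENNReal.ofReal_mul (by positivity), inv_mul_cancel₀ (by positivity)]; simp
    _ ≤ _ := by gcongr

/-- Pointwise annulus decomposition. -/
lemma aux_annulus (p : ℝ) (hp : 1 < p) (c h x v : ℝ) (hh : 0 < h) (hv : 0 ≤ v) :
    ∃ k : ℕ, x ∈ Icc (c - 2^k*h/2) (c + 2^k*h/2) ∧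
      v * h ^ (p - 1) / (h ^ p + |x - c| ^ p) ≤ v * (h⁻¹ * (4 / 2^k) ^ p) := by
  classical
  have hmem : ∀ k : ℕ, x ∈ Icc (c - 2^k*h/2) (c + 2^k*h/2) ↔ |x - c| ≤ 2^k*h/2 := by
    intro k
    rw [abs_le, mem_Icc]
    constructor <;> rintro ⟨h1, h2⟩ <;> constructor <;> linarith
  have hex : ∃ k : ℕ, |x - c| ≤ 2^k*h/2 := by
    obtain ⟨k, hk⟩ := pow_unbounded_of_one_lt (|x-c| / (h/2)) (one_lt_two : (1:ℝ) < 2)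
    refine ⟨k, ?_⟩
    rw [div_lt_iff₀ (by positivity)] at hk
    linarith
  refine ⟨Nat.find hex, (hmem _).2 (Nat.find_spec hex), ?_⟩
  have hlow : (2 ^ (Nat.find hex) * h / 4) ^ p ≤ h ^ p + |x - c| ^ p := by
    rcases hk : Nat.find hex with _ | j
    · have : (2 ^ 0 * h / 4) ^ p ≤ h ^ p :=
        Real.rpow_le_rpow (by positivity) (by norm_num; linarith) (by linarith)
      have := Real.rpow_nonneg (abs_nonneg (x-c)) p
      linarith
    · have h1 : ¬ |x - c| ≤ 2^j*h/2 := Nat.find_min hex (by omega)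
      have : (2 ^ (j+1) * h / 4) ^ p ≤ |x - c| ^ p :=
        Real.rpow_le_rpow (by positivity) (by rw [pow_succ]; linarith) (by linarith)
      have := Real.rpow_nonneg hh.le p
      linarith
  generalize Nat.find hex = k at hlow
  rw [mul_div_assoc]
  apply mul_le_mul_of_nonneg_left _ hv
  calc h ^ (p-1) / (h ^ p + |x - c| ^ p) ≤ h ^ (p-1) / (2 ^ k * h / 4) ^ p := by gcongr
    _ = h⁻¹ * (4 / 2^k) ^ p := by
      rw [Real.div_rpow (by positivity) (by norm_num), Real.mul_rpow (by positivity) hh.le,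
        Real.div_rpow (by norm_num) (by positivity), Real.rpow_sub hh, Real.rpow_one]
      have := (Real.rpow_pos_of_pos hh p).ne'
      have := (Real.rpow_pos_of_pos (show (0:ℝ) < 2^k by positivity) p).ne'
      field_simp

lemma aux_main (p : ℝ) (hp : 1 < p) (w : ℝ → ℝ) (hwm : Measurable w) (hw0 : ∀ x, 0 ≤ w x)
    (hwpos : ∀ᵐ x ∂(volume : Measure ℝ), 0 < w x) (K : ℝ) (hK : 0 < K)
    (hyp : ∀ c H : ℝ, 0 < H →
      wnormER 1 ((Icc (c - H/2) (c + H/2)).indicator fun x => ENNReal.ofReal (w x)) *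
        (∫⁻ x in Icc (c - H/2) (c + H/2), ENNReal.ofReal (w x ^ (1 - p / (p - 1)))) ^ (p - 1)
        ≤ ENNReal.ofReal (K * H ^ p)) :
    ∃ B : ℝ≥0∞, B < ∞ ∧ ∀ c h : ℝ, 0 < h →
      wnormER 1 (fun x => ENNReal.ofReal (w x * h ^ (p - 1) / (h ^ p + |x - c| ^ p))) *
      (∫⁻ x in Icc (c - h/2) (c + h/2), ENNReal.ofReal (w x ^ (1 - p / (p - 1)))) ^ (p - 1) ≤
      B * ENNReal.ofReal (h ^ (p-1)) := by
  obtain ⟨g, hg0, hg1, hdoub⟩ := aux_doubling p hp w hwm hw0 hwpos K hK hyp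
  have hp1 : 0 < p - 1 := by linarith
  set ρ : ℝ := g ^ (p-1) with hρ
  have hρ0 : 0 < ρ := by positivity
  have hρ1 : ρ < 1 := Real.rpow_lt_one hg0.le hg1 hp1
  refine ⟨∑' k : ℕ, ENNReal.ofReal (K * 4 ^ p * ρ ^ k), ?_, fun c h hh => ?_⟩
  · have : Summable fun k : ℕ => K * 4 ^ p * ρ ^ k :=
      (summable_geometric_of_lt_one hρ0.le hρ1).mul_left _
    rw [← ENNReal.ofReal_tsum_of_nonneg (fun k => by positivity) this]
    exact ENNReal.ofReal_lt_top
  set I : ℕ → Set ℝ := fun k => Icc (c - 2^k*h/2) (c + 2^k*h/2) with hI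
  set W : ℕ → ℝ≥0∞ := fun k => wnormER 1 ((I k).indicator fun x => ENNReal.ofReal (w x)) with hW
  set S : ℕ → ℝ≥0∞ := fun k => ∫⁻ x in I k, ENNReal.ofReal (w x ^ (1 - p / (p - 1))) with hS
  have hWS : ∀ k, W k * S k ^ (p-1) ≤ ENNReal.ofReal (K * (2^k*h)^p) :=
    fun k => hyp c (2^k*h) (by positivity)
  have hSS : ∀ k, S 0 ≤ ENNReal.ofReal (g^k) * S k := by
    intro k
    induction k with
    | zero => simp
    | succ k ih =>
      refine ih.trans ?_
      have h1 := hdoub c (2^k*h) (by positivity)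
      have h2 : S k ≤ ENNReal.ofReal g * S (k+1) := by
        simp only [hS, hI, pow_succ]
        convert h1 using 6 <;> ring
      rw [pow_succ, ENNReal.ofReal_mul (by positivity), mul_assoc]
      gcongr
  have hS0 : (∫⁻ x in Icc (c - h/2) (c + h/2), ENNReal.ofReal (w x ^ (1 - p / (p - 1)))) = S 0 := by
    simp [hS, hI]
  rw [hS0]
  have hWb : wnormER 1 (fun x => ENNReal.ofReal (w x * h ^ (p - 1) / (h ^ p + |x - c| ^ p)))
      ≤ ∑' k : ℕ, ENNReal.ofReal (h⁻¹ * (4 / 2^k) ^ p) * W k := by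
    apply aux_wnorm_bound
    intro t ht
    have hsub : {x | ENNReal.ofReal t < ENNReal.ofReal (w x * h ^ (p - 1) / (h ^ p + |x - c| ^ p))}
        ⊆ ⋃ k : ℕ, {x | x ∈ I k ∧ t / (h⁻¹ * (4 / 2^k) ^ p) < w x} := by
      intro x hx
      have hx' := (ENNReal.ofReal_lt_ofReal_iff_of_nonneg ht.le).1 hx
      obtain ⟨k, hk1, hk2⟩ := aux_annulus p hp c h x (w x) hh (hw0 x)
      refine mem_iUnion.2 ⟨k, hk1, ?_⟩
      rw [div_lt_iff₀ (by positivity)]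
      linarith
    calc _ ≤ ENNReal.ofReal t * ∑' k : ℕ, volume {x | x ∈ I k ∧ t / (h⁻¹ * (4 / 2^k) ^ p) < w x} := by
          gcongr
          exact (measure_mono hsub).trans (measure_iUnion_le _)
      _ = ∑' k : ℕ, ENNReal.ofReal t * volume {x | x ∈ I k ∧ t / (h⁻¹ * (4 / 2^k) ^ p) < w x} :=
          ENNReal.tsum_mul_left.symm
      _ ≤ _ := by
          refine ENNReal.tsum_le_tsum fun k => ?_
          have hA : 0 < h⁻¹ * (4 / 2^k) ^ p := by positivity
          generalize h⁻¹ * (4 / 2^k) ^ p = A at hA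
          calc _ ≤ ENNReal.ofReal t * (ENNReal.ofReal (t / A)⁻¹ * W k) := by
                gcongr
                exact aux_vol hw0 (by positivity)
            _ = _ := by
                rw [← mul_assoc, ← ENNReal.ofReal_mul ht.le]
                congr 2
                field_simp
  calc _ ≤ (∑' k : ℕ, ENNReal.ofReal (h⁻¹ * (4 / 2^k) ^ p) * W k) * S 0 ^ (p-1) := by gcongr
    _ = ∑' k : ℕ, ENNReal.ofReal (h⁻¹ * (4 / 2^k) ^ p) * W k * S 0 ^ (p-1) :=
        ENNReal.tsum_mul_right.symm
    _ ≤ ∑' k : ℕ, ENNReal.ofReal (K * 4 ^ p * ρ ^ k) * ENNReal.ofReal (h ^ (p-1)) := by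
        refine ENNReal.tsum_le_tsum fun k => ?_
        calc _ ≤ ENNReal.ofReal (h⁻¹ * (4 / 2^k) ^ p) * W k *
              (ENNReal.ofReal (g^k) * S k) ^ (p-1) := by gcongr; exact hSS k
          _ = ENNReal.ofReal (h⁻¹ * (4 / 2^k) ^ p) * ENNReal.ofReal (ρ^k) *
              (W k * S k ^ (p-1)) := by
            rw [ENNReal.mul_rpow_of_nonneg _ _ hp1.le, ENNReal.ofReal_rpow_of_pos (by positivity)]
            have : (g ^ k) ^ (p-1) = ρ ^ k := by
              rw [hρ, ← Real.rpow_natCast, ← Real.rpow_natCast, ← Real.rpow_mul hg0.le,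
                ← Real.rpow_mul hg0.le, mul_comm]
            rw [this]; ring
          _ ≤ ENNReal.ofReal (h⁻¹ * (4 / 2^k) ^ p) * ENNReal.ofReal (ρ^k) *
              ENNReal.ofReal (K * (2^k*h)^p) := by gcongr; exact hWS k
          _ = _ := by
            rw [← ENNReal.ofReal_mul (by positivity), ← ENNReal.ofReal_mul (by positivity),
              ← ENNReal.ofReal_mul (by positivity)]
            congr 1
            rw [Real.mul_rpow (by positivity) hh.le,
              Real.div_rpow (by norm_num) (by positivity), Real.rpow_sub hh, Real.rpow_one]
            have := (Real.rpow_pos_of_pos (show (0:ℝ) < 2^k by positivity) p).ne'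
            field_simp
    _ = _ := ENNReal.tsum_mul_right

/-- Turn averages into plain integrals. -/
lemma aux_scale {p H : ℝ} (hp : 1 < p) (hH : 0 < H) (S : ℝ≥0∞) :
    S ^ (p-1) = ENNReal.ofReal (H ^ (p-1)) * ((ENNReal.ofReal H)⁻¹ * S) ^ (p-1) := by
  have hp1 : 0 < p - 1 := by linarith
  rw [ENNReal.mul_rpow_of_nonneg _ _ hp1.le, ← ENNReal.ofReal_rpow_of_pos hH, ← mul_assoc,
    ENNReal.inv_rpow, ENNReal.mul_inv_cancel, one_mul]
  · simp [ENNReal.rpow_eq_zero_iff, hH, hp1.le]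
  · exact ENNReal.rpow_ne_top_of_nonneg hp1.le ENNReal.ofReal_ne_top

/-- For `1 < p < ∞` and a weight `w` on `ℝ`, `w ∈ A_p^*` if and only if
`sup_Q ‖w(x)·|Q|^{p-1}/(|Q|^p + |x - x_Q|^p)‖_{L^{1,∞}}·(⨍_Q w^{1-p'})^{p-1} < ∞`, where the
supremum runs over bounded intervals `Q`, `x_Q` is the center of `Q`, and the weak norm is
taken over all of `ℝ`. -/
theorem statement13 (p : ℝ) (hp : 1 < p)
    (w : ℝ → ℝ) (hwm : Measurable w) (hw0 : ∀ x, 0 ≤ w x)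
    (hwpos : ∀ᵐ x ∂(volume : Measure ℝ), 0 < w x) :
    ApStarConstR p w < ∞ ↔
      (⨆ (a : ℝ) (h : ℝ) (_ : 0 < h),
        wnormER 1 (fun x =>
            ENNReal.ofReal (w x * h ^ (p - 1) / (h ^ p + |x - (a + h / 2)| ^ p))) *
          ((volume (Set.Icc a (a + h)))⁻¹ *
              ∫⁻ x in Set.Icc a (a + h),
                ENNReal.ofReal (w x ^ (1 - p / (p - 1)))) ^ (p - 1)) < ∞ := by
  have hp1 : 0 < p - 1 := by linarith
  have hvol : ∀ a h : ℝ, volume (Icc a (a + h)) = ENNReal.ofReal h := by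
    intro a h; rw [Real.volume_Icc]; congr 1; ring
  constructor
  · intro hfin
    set K : ℝ := (ApStarConstR p w).toReal + 1 with hKdef
    have hK : 0 < K := by positivity
    have hKle : ApStarConstR p w ≤ ENNReal.ofReal K := by
      rw [← ENNReal.ofReal_toReal hfin.ne]
      exact ENNReal.ofReal_le_ofReal (by linarith)
    have hyp : ∀ c H : ℝ, 0 < H →
      wnormER 1 ((Icc (c - H/2) (c + H/2)).indicator fun x => ENNReal.ofReal (w x)) *
        (∫⁻ x in Icc (c - H/2) (c + H/2), ENNReal.ofReal (w x ^ (1 - p / (p - 1)))) ^ (p - 1)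
        ≤ ENNReal.ofReal (K * H ^ p) := by
      intro c H hH
      have h1 := le_iSup_of_le (f := fun a => ⨆ (h : ℝ) (_ : 0 < h),
        (volume (Set.Icc a (a + h)))⁻¹ *
        wnormER 1 ((Set.Icc a (a + h)).indicator fun x => ENNReal.ofReal (w x)) *
      ((volume (Set.Icc a (a + h)))⁻¹ *
          ∫⁻ x in Set.Icc a (a + h), ENNReal.ofReal (w x ^ (1 - p / (p - 1)))) ^ (p - 1))
        (c - H/2) (le_iSup₂_of_le H hH le_rfl)
      have h2 := h1.trans hKle
      rw [hvol, show c - H/2 + H = c + H/2 by ring] at h2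
      rw [aux_scale hp hH]
      have hHi : (ENNReal.ofReal H)⁻¹ = ENNReal.ofReal H⁻¹ := (ENNReal.ofReal_inv_of_pos hH).symm
      generalize wnormER 1 ((Icc (c - H/2) (c + H/2)).indicator fun x => ENNReal.ofReal (w x)) = W
        at h2 ⊢
      generalize ((ENNReal.ofReal H)⁻¹ * ∫⁻ x in Icc (c - H/2) (c + H/2),
        ENNReal.ofReal (w x ^ (1 - p / (p - 1)))) ^ (p - 1) = T at h2 ⊢
      rw [hHi] at h2
      calc W * (ENNReal.ofReal (H ^ (p-1)) * T)
          = ENNReal.ofReal (H ^ p) * (ENNReal.ofReal H⁻¹ * W * T) := by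
            have : H ^ (p-1) = H ^ p * H⁻¹ := by
              rw [Real.rpow_sub hH, Real.rpow_one, div_eq_mul_inv]
            rw [this, ENNReal.ofReal_mul (by positivity)]; ring
        _ ≤ ENNReal.ofReal (H ^ p) * ENNReal.ofReal K := by gcongr
        _ = _ := by rw [← ENNReal.ofReal_mul (by positivity), mul_comm]
    obtain ⟨B, hB, hmain⟩ := aux_main p hp w hwm hw0 hwpos K hK hyp
    refine lt_of_le_of_lt (iSup_le fun a => iSup₂_le fun h hh => ?_) hB
    have h1 := hmain (a + h/2) h hh
    rw [show a + h/2 - h/2 = a by ring, show a + h/2 + h/2 = a + h by ring, aux_scale hp hh] at h1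
    rw [hvol]
    have hne : ENNReal.ofReal (h ^ (p-1)) ≠ 0 := by
      rw [Ne, ENNReal.ofReal_eq_zero, not_le]; positivity
    refine (ENNReal.mul_le_mul_iff_left hne ENNReal.ofReal_ne_top).1 (le_trans (le_of_eq ?_) h1)
    ring
  · intro hfin
    refine lt_of_le_of_lt ?_ (ENNReal.mul_lt_top (ENNReal.ofReal_lt_top (r := 2)) hfin)
    unfold ApStarConstR
    refine iSup_le fun a => iSup₂_le fun h hh => ?_
    refine le_trans ?_ (mul_le_mul_right (le_iSup_of_le a (le_iSup₂_of_le h hh le_rfl)) _)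
    rw [← mul_assoc]
    refine mul_le_mul' ?_ le_rfl
    rw [hvol, ← ENNReal.ofReal_inv_of_pos hh]
    have : wnormER 1 ((Set.Icc a (a + h)).indicator fun x => ENNReal.ofReal (w x)) ≤
        ENNReal.ofReal (2 * h) * wnormER 1 (fun x =>
            ENNReal.ofReal (w x * h ^ (p - 1) / (h ^ p + |x - (a + h / 2)| ^ p))) := by
      apply aux_wnorm_bound
      intro t ht
      rw [aux_level hw0 ht]
      calc ENNReal.ofReal t * volume {x | x ∈ Icc a (a+h) ∧ t < w x}
          ≤ ENNReal.ofReal (2 * h) * (ENNReal.ofReal (t / (2*h)) *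
            volume {x | ENNReal.ofReal (t / (2*h)) <
              ENNReal.ofReal (w x * h ^ (p - 1) / (h ^ p + |x - (a + h / 2)| ^ p))}) := by
            rw [← mul_assoc, ← ENNReal.ofReal_mul (by positivity),
              mul_div_cancel₀ _ (by positivity)]
            refine mul_le_mul' le_rfl (measure_mono ?_)
            intro x hx0
            obtain ⟨hx, htx⟩ := hx0
            refine (ENNReal.ofReal_lt_ofReal_iff_of_nonneg (by positivity)).2 ?_
            have habs : |x - (a + h/2)| ≤ h := by
              rw [abs_le]; constructor <;> linarith [hx.1, hx.2]
            have h1 : |x - (a + h/2)| ^ p ≤ h ^ p :=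
              Real.rpow_le_rpow (abs_nonneg _) habs (by linarith)
            have h0 := Real.rpow_nonneg (abs_nonneg (x - (a + h/2))) p
            have hhp := Real.rpow_pos_of_pos hh p
            have hhp1 := Real.rpow_pos_of_pos hh (p-1)
            calc t / (2*h) < w x / (2*h) := by gcongr
              _ = w x * h ^ (p-1) / (2 * h ^ p) := by
                rw [Real.rpow_sub hh, Real.rpow_one]; field_simp
              _ ≤ _ := by
                have := hw0 x
                apply div_le_div_of_nonneg_left (by positivity) (by positivity) (by linarith)
        _ ≤ _ := by
            gcongr
            exact aux_wnorm_le (by positivity)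
    calc _ ≤ ENNReal.ofReal h⁻¹ * (ENNReal.ofReal (2 * h) * wnormER 1 (fun x =>
            ENNReal.ofReal (w x * h ^ (p - 1) / (h ^ p + |x - (a + h / 2)| ^ p)))) := by gcongr
      _ = _ := by
        rw [← mul_assoc, ← ENNReal.ofReal_mul (by positivity)]
        congr 2
        field_simp
end
end

section
/- Let n ≥ 1, 0 < α < n, 1 < p < n/α, and let q be defined by 1/p − 1/q = α/n, and let w be a weight on ℝⁿ. Suppose there exists a constant C > 0 such that ‖w·M_α f‖_{L^{q,∞}} ≤ C·‖f‖_{L^p(w^p)} for every f ∈ L^p(w^p). Then there is a constant C' depending only on n, p, and α such that for every cube Q with 0 < ∫_Q w^{−p'} dx < ∞ (where p' = p/(p−1), σ := w^{−p'}), one has |Q|^{α/n − 1}·‖w·χ_Q‖_{L^{q,∞}}·(∫_Q σ dx)^{1/p'} ≤ C'·C. -/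
open MeasureTheory Set
open scoped ENNReal

noncomputable section

/-- There is `C' = C'(n,p,α) > 0` such that whenever the multiplier
weak-type inequality `‖w·M_α f‖_{L^{q,∞}} ≤ C·‖f‖_{L^p(w^p)}` holds for all `f ∈ L^p(w^p)`,
then for every cube `Q` with `0 < ∫_Q w^{-p'} < ∞` (`σ := w^{-p'}`) one has
`|Q|^{α/n - 1}·‖w·χ_Q‖_{L^{q,∞}}·(∫_Q σ)^{1/p'} ≤ C'·C`. -/
theorem statement15 (n : ℕ) (hn : 1 ≤ n) (α : ℝ) (hα : 0 < α) (hαn : α < (n : ℝ))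
    (p : ℝ) (hp : 1 < p) (hpn : p < (n : ℝ) / α) (q : ℝ)
    (hq : 1 / p - 1 / q = α / (n : ℝ)) :
    ∃ C' : ℝ, 0 < C' ∧
      ∀ w : (Fin n → ℝ) → ℝ, Measurable w → (∀ x, 0 ≤ w x) →
        (∀ᵐ x ∂(volume : Measure (Fin n → ℝ)), 0 < w x) →
        ∀ C : ℝ, 0 < C →
          (∀ f : (Fin n → ℝ) → ℝ, Measurable f →
            (∫⁻ x, ENNReal.ofReal (|f x| ^ p * w x ^ p)) < ∞ →
            wnormE n q (fun x => ENNReal.ofReal (w x) * fracMaximalFn n α f x) ≤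
              ENNReal.ofReal C * (∫⁻ x, ENNReal.ofReal (|f x| ^ p * w x ^ p)) ^ (1 / p)) →
          ∀ Q : Set (Fin n → ℝ), IsCube n Q →
            0 < (∫⁻ x in Q, ENNReal.ofReal (w x ^ (-(p / (p - 1))))) →
            (∫⁻ x in Q, ENNReal.ofReal (w x ^ (-(p / (p - 1))))) < ∞ →
            volume Q ^ (α / (n : ℝ) - 1) *
                wnormE n q (Q.indicator fun x => ENNReal.ofReal (w x)) *
                (∫⁻ x in Q, ENNReal.ofReal (w x ^ (-(p / (p - 1))))) ^ (1 - 1 / p) ≤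
              ENNReal.ofReal (C' * C) := by
  refine ⟨1, one_pos, ?_⟩
  intro w hw hw0 _ C hC H Q hQ hS0 hS
  set S := ∫⁻ x in Q, ENNReal.ofReal (w x ^ (-(p / (p - 1)))) with hSdef
  obtain ⟨a, h, hh, hQe⟩ := id hQ
  have hQm : MeasurableSet Q := by
    rw [hQe]; exact MeasurableSet.univ_pi fun i => measurableSet_Icc
  have hvol : volume Q = ENNReal.ofReal h ^ n := by
    rw [hQe, volume_pi_pi]; simp
  have hv0 : volume Q ≠ 0 := by
    rw [hvol]; exact pow_ne_zero _ (by simpa using hh)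
  have hvt : volume Q ≠ ∞ := by
    rw [hvol]; exact ENNReal.pow_ne_top ENNReal.ofReal_ne_top
  have hp0 : 0 < p := by linarith
  have hp1 : 0 < p - 1 := by linarith
  have hpp : 0 < p / (p - 1) := div_pos hp0 hp1
  let f : (Fin n → ℝ) → ℝ := Q.indicator fun x => w x ^ (-(p / (p - 1)))
  have hf : Measurable f := (hw.pow_const _).indicator hQm
  have habs : ∀ y, ENNReal.ofReal |f y| =
      Q.indicator (fun x => ENNReal.ofReal (w x ^ (-(p / (p - 1))))) y := by
    intro y
    by_cases hy : y ∈ Q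
    · simp only [f, indicator_of_mem hy]
      rw [abs_of_nonneg (Real.rpow_nonneg (hw0 y) _)]
    · simp [f, indicator_of_notMem hy]
  have hfp : (∫⁻ x, ENNReal.ofReal (|f x| ^ p * w x ^ p)) = S := by
    rw [hSdef, ← lintegral_indicator hQm]
    refine lintegral_congr fun y => ?_
    by_cases hy : y ∈ Q
    · simp only [f, indicator_of_mem hy]
      rw [abs_of_nonneg (Real.rpow_nonneg (hw0 y) _)]
      congr 1
      rcases (hw0 y).eq_or_lt with h0 | h0
      · rw [← h0, Real.zero_rpow (by linarith), Real.zero_rpow hp0.ne', zero_mul]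
      · rw [← Real.rpow_mul h0.le, ← Real.rpow_add h0]
        congr 1
        field_simp
        ring
    · simp [f, indicator_of_notMem hy, Real.zero_rpow hp0.ne']
  have key := H f hf (by rw [hfp]; exact hS)
  rw [hfp] at key
  have hfQ : ∫⁻ y in Q, ENNReal.ofReal |f y| = S := by
    refine setLIntegral_congr_fun hQm fun y hy => ?_
    simp only [habs, indicator_of_mem hy]
  have hA : volume Q ^ (α / (n : ℝ)) * ((volume Q)⁻¹ * S) =
      volume Q ^ (α / (n : ℝ) - 1) * S := by
    rw [← mul_assoc, sub_eq_add_neg, ENNReal.rpow_add _ _ hv0 hvt, ENNReal.rpow_neg_one]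
  set A := volume Q ^ (α / (n : ℝ) - 1) * S with hAdef
  have hA0 : A ≠ 0 := mul_ne_zero (ENNReal.rpow_pos (pos_iff_ne_zero.2 hv0) hvt |>.ne') hS0.ne'
  have hAt : A ≠ ∞ := ENNReal.mul_ne_top (ENNReal.rpow_ne_top_of_ne_zero hv0 hvt) hS.ne
  have hM : ∀ x ∈ Q, A ≤ fracMaximalFn n α f x := by
    intro x hx
    unfold fracMaximalFn
    refine le_iSup_of_le Q (le_iSup_of_le hQ (le_iSup_of_le hx ?_))
    rw [hfQ, hA]
  have hmain : A * wnormE n q (Q.indicator fun x => ENNReal.ofReal (w x)) ≤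
      ENNReal.ofReal C * S ^ (1 / p) := by
    have hq0 : 0 ≤ 1 / q := by
      have hnpos : (0 : ℝ) < n := by exact_mod_cast hn
      have h1 : α / (n : ℝ) < 1 / p := by
        rw [lt_div_iff₀ hα] at hpn
        rw [div_lt_div_iff₀ hnpos hp0]
        linarith
      linarith
    refine le_trans ?_ key
    unfold wnormE
    simp only [ENNReal.mul_iSup]
    refine iSup₂_le fun t ht => ?_
    have hAr : 0 < A.toReal := ENNReal.toReal_pos hA0 hAt
    refine le_iSup₂_of_le (A.toReal * t) (mul_pos hAr ht) ?_
    rw [ENNReal.ofReal_mul hAr.le, ENNReal.ofReal_toReal hAt, ← mul_assoc]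
    refine mul_le_mul_right (ENNReal.rpow_le_rpow (measure_mono ?_) hq0) _
    intro x hx
    simp only [mem_setOf_eq] at hx ⊢
    by_cases hxQ : x ∈ Q
    · rw [indicator_of_mem hxQ] at hx
      calc A * ENNReal.ofReal t < A * ENNReal.ofReal (w x) :=
            ENNReal.mul_lt_mul_right hA0 hAt hx
        _ = ENNReal.ofReal (w x) * A := mul_comm _ _
        _ ≤ _ := mul_le_mul_right (hM x hxQ) _
    · rw [indicator_of_notMem hxQ] at hx
      simp at hx
  have hSp0 : S ^ (1 / p) ≠ 0 := (ENNReal.rpow_pos hS0 hS.ne).ne'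
  have hSpt : S ^ (1 / p) ≠ ∞ := ENNReal.rpow_ne_top_of_ne_zero hS0.ne' hS.ne
  rw [one_mul, ← ENNReal.mul_le_mul_iff_left hSp0 hSpt]
  refine le_trans (le_of_eq ?_) hmain
  have hSS : S ^ (1 - 1 / p) * S ^ (1 / p) = S := by
    rw [← ENNReal.rpow_add _ _ hS0.ne' hS.ne]; simp
  rw [mul_assoc, hSS, hAdef]
  ring
end
end
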